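/- arXiv:2007.12373 — 4 statements merged into one kernel-verified Lean document; each statement's English description precedes it below -/
import Mathlib

section
/- For every infinite cardinal τ there exists a Hausdorff space X that is almost strictly a_τ-subcompact but is not a_τ-subcompact. -/
open Cardinal Topology

universe u

/-- A Hausdorff space is *subcompact* if it admits a condensation (continuous bijection)
onto a compact Hausdorff space. -/
def Subcompact (X : Type u) [TopologicalSpace X] : Prop :=
  ∃ (Y : Type u) (_ : TopologicalSpace Y), CompactSpace Y ∧ T2Space Y ∧
    ∃ f : X → Y, Continuous f ∧ Function.Bijective f

/-- A compact Hausdorff space `X` is an `a_τ`-space if for every `C ⊆ X` with `#C ≤ τ`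
there is a condensation from the subspace `X \ C` onto a compact Hausdorff space. -/
def ATauSpace (τ : Cardinal.{u}) (X : Type u) [TopologicalSpace X] : Prop :=
  CompactSpace X ∧ T2Space X ∧ ∀ C : Set X, #C ≤ τ → Subcompact ↥(Cᶜ)

/-- A compact Hausdorff space `X` is a strictly `a_τ`-space if for every `C ⊆ X` with
`#C ≤ τ` there is a condensation from `X \ C` onto a compact Hausdorff space `K`
extending to a continuous map `X → K` (encoded: a continuous `g : X → K` whose
restriction to `X \ C` is bijective). -/
def StrictATauSpace (τ : Cardinal.{u}) (X : Type u) [TopologicalSpace X] : Prop :=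
  CompactSpace X ∧ T2Space X ∧ ∀ C : Set X, #C ≤ τ →
    ∃ (K : Type u) (_ : TopologicalSpace K), CompactSpace K ∧ T2Space K ∧
      ∃ g : X → K, Continuous g ∧ Function.Bijective fun x : ↥(Cᶜ) => g x

/-- A Hausdorff space `X` is `a_τ`-subcompact if for every `C ⊆ X` with `#C ≤ τ` there
is a condensation from `X \ C` onto an `a_τ`-space. -/
def ATauSubcompact (τ : Cardinal.{u}) (X : Type u) [TopologicalSpace X] : Prop :=
  ∀ C : Set X, #C ≤ τ →
    ∃ (Y : Type u) (_ : TopologicalSpace Y), ATauSpace τ Y ∧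
      ∃ f : ↥(Cᶜ) → Y, Continuous f ∧ Function.Bijective f

/-- A Hausdorff space `X` is strictly `a_τ`-subcompact if for every `C ⊆ X` with `#C ≤ τ`
there is a condensation from `X \ C` onto a strictly `a_τ`-space `Y` extending to a
continuous map `X → Y`. -/
def StrictATauSubcompact (τ : Cardinal.{u}) (X : Type u) [TopologicalSpace X] : Prop :=
  ∀ C : Set X, #C ≤ τ →
    ∃ (Y : Type u) (_ : TopologicalSpace Y), StrictATauSpace τ Y ∧
      ∃ g : X → Y, Continuous g ∧ Function.Bijective fun x : ↥(Cᶜ) => g x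

/-- A Hausdorff space `X` is almost strictly `a_τ`-subcompact if for every `C ⊆ X` with
`#C ≤ τ` there is a condensation from `X \ C` onto a compact Hausdorff space `Y`
extending to a continuous map `X → Y`. -/
def AlmostStrictATauSubcompact (τ : Cardinal.{u}) (X : Type u) [TopologicalSpace X] : Prop :=
  ∀ C : Set X, #C ≤ τ →
    ∃ (Y : Type u) (_ : TopologicalSpace Y), CompactSpace Y ∧ T2Space Y ∧
      ∃ g : X → Y, Continuous g ∧ Function.Bijective fun x : ↥(Cᶜ) => g x


section helpers

open Filter Set

theorem exists_P (D : Type u) (hD : Uncountable D) :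
    ∃ (P : Type u) (_ : TopologicalSpace P) (inf : P), CompactSpace P ∧ T2Space P ∧
      (𝓝[≠] inf).NeBot ∧ ∀ S : Set P, S.Countable → inf ∉ S →
        ∃ K : Set P, IsClosed K ∧ inf ∉ K ∧ S ⊆ K := by
  let L : Set (Ultrafilter D) := {u | ∃ A ∈ u, A.Countable}
  have hLo : IsOpen L := by
    have : L = ⋃ A ∈ {A : Set D | A.Countable}, {u : Ultrafilter D | A ∈ u} := by
      ext u; simp [L, and_comm]
    rw [this]
    exact isOpen_biUnion fun A _ => ultrafilter_isOpen_basic A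
  have : LocallyCompactSpace L := hLo.locallyCompactSpace
  have : NoncompactSpace L := by
    rw [← not_compactSpace_iff, ← isCompact_iff_compactSpace]
    intro hc
    have h1 : L = Set.univ := by
      rw [← hc.isClosed.closure_eq]
      apply Dense.closure_eq
      refine denseRange_pure.mono ?_
      rintro _ ⟨d, rfl⟩
      exact ⟨{d}, by simp, by simp⟩
    have hne : (cocountable : Filter D).NeBot := by
      rw [neBot_iff]
      intro h
      have : (∅ : Set D) ∈ (cocountable : Filter D) := by rw [h]; trivial
      rw [mem_cocountable] at this
      simp [countable_univ_iff] at this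
    have h2 : Ultrafilter.of (cocountable : Filter D) ∈ L := by rw [h1]; trivial
    obtain ⟨A, hA, hAc⟩ := h2
    have h3 : Aᶜ ∈ Ultrafilter.of (cocountable : Filter D) := by
      apply Ultrafilter.of_le
      rw [mem_cocountable]; simpa using hAc
    exact Ultrafilter.compl_mem_iff_notMem.1 h3 hA
  refine ⟨OnePoint L, inferInstance, OnePoint.infty, inferInstance, inferInstance, inferInstance, ?_⟩
  intro S hS hi
  have hT : ((↑) ⁻¹' S : Set L).Countable :=
    hS.preimage OnePoint.coe_injective
  choose A hA hAc using fun u : L => u.2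
  let B : Set D := ⋃ u ∈ ((↑) ⁻¹' S : Set L), A u
  have hB : B.Countable := hT.biUnion fun u _ => hAc u
  let K : Set L := {u | B ∈ u.1}
  have hKc : IsCompact K := by
    rw [Subtype.isCompact_iff]
    have : ((↑) : L → Ultrafilter D) '' K = {u | B ∈ u} := by
      ext u
      constructor
      · rintro ⟨v, hv, rfl⟩; exact hv
      · intro hu; exact ⟨⟨u, B, hu, hB⟩, hu, rfl⟩
    rw [this]
    exact (ultrafilter_isClosed_basic B).isCompact
  refine ⟨(↑) '' K, ?_, ?_, ?_⟩
  · rw [OnePoint.isClosed_image_coe]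
    exact ⟨hKc.isClosed, hKc⟩
  · rintro ⟨u, _, h⟩
    exact OnePoint.coe_ne_infty u h
  · intro x hx
    induction x using OnePoint.rec with
    | infty => exact absurd hx hi
    | coe u =>
      refine ⟨u, ?_, rfl⟩
      exact mem_of_superset (hA u) (subset_biUnion_of_mem (u := A) (show u ∈ _ from hx))

/-- The set of exceptional points `(inf, d)`. -/
def Del {P D : Type u} (inf : P) : Set (P × Ultrafilter D) := {x | ∃ d : D, x = (inf, pure d)}

theorem notMem_Del {P D : Type u} {inf : P} {U : Ultrafilter D} (hU : (U : Filter D) ≤ cofinite) :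
    (inf, U) ∉ Del (D := D) inf := by
  rintro ⟨d, hd⟩
  have h : U = pure d := (Prod.ext_iff.1 hd).2
  have h2 : ({d}ᶜ : Set D) ∈ (U : Filter D) := hU (by simp)
  rw [h] at h2
  simp at h2

theorem exists_nonprincipal {D : Type u} {N : Set D} (hN : N.Infinite) :
    ∃ U : Ultrafilter D, (U : Filter D) ≤ cofinite ∧ N ∈ U := by
  have : (cofinite ⊓ 𝓟 N : Filter D).NeBot := cofinite_inf_principal_neBot_iff.2 hN
  refine ⟨Ultrafilter.of (cofinite ⊓ 𝓟 N), (Ultrafilter.of_le _).trans inf_le_left, ?_⟩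
  exact le_principal_iff.1 ((Ultrafilter.of_le _).trans inf_le_right)

/-- Diagonalisation. -/
theorem exists_diag {D : Type u} {N : Set D} (hN : N.Infinite) (u : D → Ultrafilter D)
    (hu : ∀ d ∈ N, (u d : Filter D) ≤ cofinite) :
    ∃ A ⊆ N, A.Infinite ∧ ∀ d ∈ A, A ∉ u d := by
  have := hN.to_subtype
  let e0 : ℕ × ℕ ↪ N := (Nat.pairEquiv.toEmbedding).trans (Infinite.natEmbedding N)
  let e : ℕ × ℕ → D := fun x => e0 x
  have he : Function.Injective e := Subtype.val_injective.comp e0.injective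
  have heN : ∀ x, e x ∈ N := fun x => (e0 x).2
  let Q : ℕ → Set D := fun i => range fun j => e (i, j)
  by_cases h : ∀ i, ∃ j, Q i ∈ u (e (i, j))
  · choose j hj using h
    refine ⟨range fun i => e (i, j i), ?_, ?_, ?_⟩
    · rintro _ ⟨i, rfl⟩; exact heN _
    · apply infinite_range_of_injective
      intro a b hab
      exact (Prod.ext_iff.1 (he hab)).1
    · rintro _ ⟨i, rfl⟩ hmem
      have h1 := inter_mem (f := (u (e (i, j i)) : Filter D)) hmem (hj i)
      have h2 : ({e (i, j i)}ᶜ : Set D) ∈ (u (e (i, j i)) : Filter D) :=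
        hu _ (heN _) (by simp)
      obtain ⟨x, ⟨⟨a, rfl⟩, ⟨b, hb⟩⟩, hx⟩ := (u (e (i, j i))).neBot.nonempty_of_mem (inter_mem h1 h2)
      have := (Prod.ext_iff.1 (he hb)).1
      simp only at this
      subst this
      exact hx rfl
  · push Not at h
    obtain ⟨i, hi⟩ := h
    refine ⟨Q i, ?_, ?_, ?_⟩
    · rintro _ ⟨j, rfl⟩; exact heN _
    · apply infinite_range_of_injective
      intro a b hab
      exact (Prod.ext_iff.1 (he hab)).2
    · rintro _ ⟨j, rfl⟩; exact hi j

section main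

set_option linter.unusedSectionVars false

variable {P D Z : Type u} [TopologicalSpace P] [TopologicalSpace Z]
  [CompactSpace P] [T2Space P] [CompactSpace Z] [T2Space Z] {inf : P}

theorem exists_H (V : Ultrafilter P) (F : P × Ultrafilter D → Z) :
    ∃ H : D → Z, ∀ d, Tendsto (fun p => F (p, pure d)) V (𝓝 (H d)) := by
  have : ∀ d : D, ∃ z, Tendsto (fun p => F (p, pure d)) V (𝓝 z) := by
    intro d
    obtain ⟨z, _, hz⟩ := isCompact_univ.ultrafilter_le_nhds (V.map fun p => F (p, pure d)) (by simp)
    exact ⟨z, hz⟩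
  choose H hH using this
  exact ⟨H, hH⟩

theorem H_tendsto {V : Ultrafilter P} (hV : (V : Filter P) ≤ 𝓝[≠] inf)
    {F : P × Ultrafilter D → Z} (hF : ContinuousOn F (Del inf)ᶜ)
    {H : D → Z} (hH : ∀ d, Tendsto (fun p => F (p, pure d)) V (𝓝 (H d)))
    (U : Ultrafilter D) (hU : (U : Filter D) ≤ cofinite) :
    Tendsto H U (𝓝 (F (inf, U))) := by
  rw [(closed_nhds_basis (F (inf, U))).tendsto_right_iff]
  rintro K ⟨hK, hKc⟩
  have h1 := hF (inf, U) (notMem_Del hU) hK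
  rw [mem_map, mem_nhdsWithin_iff_exists_mem_nhds_inter] at h1
  obtain ⟨W, hW, hWs⟩ := h1
  rw [nhds_prod_eq, mem_prod_iff] at hW
  obtain ⟨A, hA, B, hB, hAB⟩ := hW
  filter_upwards [(Ultrafilter.tendsto_pure_self U) hB] with d hd
  refine hKc.mem_of_tendsto (hH d) ?_
  have hA' : A ∈ (V : Filter P) := hV (mem_nhdsWithin_of_mem_nhds hA)
  have hne : ({inf}ᶜ : Set P) ∈ (V : Filter P) := hV self_mem_nhdsWithin
  filter_upwards [hA', hne] with p hp hpn
  apply hWs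
  refine ⟨hAB ⟨hp, hd⟩, ?_⟩
  rintro ⟨d', hd'⟩
  exact hpn (Prod.ext_iff.1 hd').1

theorem H_fiber {F : P × Ultrafilter D → Z}
    (hFi : InjOn F (Del inf)ᶜ) {H : D → Z}
    (hT : ∀ U : Ultrafilter D, (U : Filter D) ≤ cofinite → Tendsto H U (𝓝 (F (inf, U))))
    (z : Z) : (H ⁻¹' {z}).Finite := by
  by_contra hinf
  replace hinf : (H ⁻¹' {z}).Infinite := hinf
  have key : ∀ U : Ultrafilter D, (U : Filter D) ≤ cofinite → H ⁻¹' {z} ∈ U → F (inf, U) = z := by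
    intro U hU hz
    refine tendsto_nhds_unique (hT U hU) ?_
    refine tendsto_const_nhds.congr' ?_
    filter_upwards [hz] with d hd using hd.symm
  obtain ⟨U, hU, hUz⟩ := exists_nonprincipal hinf
  obtain ⟨A, hAs, hA, hAn⟩ := exists_diag hinf (fun _ => U) (fun _ _ => hU)
  obtain ⟨d, hd⟩ := hA.nonempty
  obtain ⟨U', hU', hUA⟩ := exists_nonprincipal hA
  have := hFi (notMem_Del hU) (notMem_Del hU')
    ((key U hU hUz).trans (key U' hU' (mem_of_superset hUA hAs)).symm)
  have h2 : U = U' := (Prod.ext_iff.1 this).2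
  exact hAn d hd (h2 ▸ hUA)

theorem H_finite (hP : ∀ S : Set P, S.Countable → inf ∉ S →
        ∃ K : Set P, IsClosed K ∧ inf ∉ K ∧ S ⊆ K) {F : P × Ultrafilter D → Z}
    (hF : ContinuousOn F (Del inf)ᶜ)
    (hFi : InjOn F (Del inf)ᶜ) {H : D → Z}
    (hT : ∀ U : Ultrafilter D, (U : Filter D) ≤ cofinite → Tendsto H U (𝓝 (F (inf, U)))) :
    {d | H d ∈ F '' (Del inf)ᶜ}.Finite := by
  by_contra hinf
  replace hinf : {d | H d ∈ F '' (Del inf)ᶜ}.Infinite := hinf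
  have hex : ∀ d, ∃ x : P × Ultrafilter D, H d ∈ F '' (Del inf)ᶜ → x ∈ (Del inf)ᶜ ∧ F x = H d := by
    intro d
    by_cases h : H d ∈ F '' (Del inf)ᶜ
    · obtain ⟨x, hx⟩ := h
      exact ⟨x, fun _ => hx⟩
    · obtain ⟨d', _⟩ := hinf.nonempty
      exact ⟨(inf, pure d'), fun h' => absurd h' h⟩
  choose x hx using hex
  have hsplit : {d | H d ∈ F '' (Del inf)ᶜ} =
      {d | H d ∈ F '' (Del inf)ᶜ ∧ (x d).1 ≠ inf} ∪
        {d | H d ∈ F '' (Del inf)ᶜ ∧ (x d).1 = inf} := by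
    ext d; simp only [mem_ofPred_eq, mem_union]; tauto
  rw [hsplit, infinite_union] at hinf
  rcases hinf with hinf | hinf
  · obtain ⟨N, hNs, hN, hNc⟩ : ∃ N ⊆ {d | H d ∈ F '' (Del inf)ᶜ ∧ (x d).1 ≠ inf},
        N.Infinite ∧ N.Countable := by
      have := hinf.to_subtype
      refine ⟨range fun n => ((Infinite.natEmbedding _ n :
        {d | H d ∈ F '' (Del inf)ᶜ ∧ (x d).1 ≠ inf}) : D), ?_, ?_, countable_range _⟩
      · rintro _ ⟨n, rfl⟩; exact Subtype.property _
      · exact infinite_range_of_injective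
          (Subtype.val_injective.comp (Infinite.natEmbedding _).injective)
    obtain ⟨K, hK, hKi, hKs⟩ := hP ((fun d => (x d).1) '' N) (hNc.image _) (by
      rintro ⟨d, hd, h⟩; exact (hNs hd).2 h)
    have hsub : K ×ˢ (Set.univ : Set (Ultrafilter D)) ⊆ (Del inf)ᶜ := by
      rintro y ⟨hy, _⟩ ⟨d, hd⟩
      rw [hd] at hy; exact hKi hy
    have hcomp : IsCompact (F '' (K ×ˢ Set.univ)) :=
      (hK.isCompact.prod isCompact_univ).image_of_continuousOn (hF.mono hsub)
    obtain ⟨U, hU, hUN⟩ := exists_nonprincipal hN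
    have hmem : F (inf, U) ∈ F '' (K ×ˢ Set.univ) := by
      refine hcomp.isClosed.mem_of_tendsto (hT U hU) ?_
      filter_upwards [hUN] with d hd
      exact ⟨x d, ⟨hKs ⟨d, hd, rfl⟩, trivial⟩, (hx d (hNs hd).1).2⟩
    obtain ⟨y, hy, hyF⟩ := hmem
    have := hFi (hsub hy) (notMem_Del hU) hyF
    rw [this] at hy
    exact hKi hy.1
  · have hnp : ∀ d ∈ {d | H d ∈ F '' (Del inf)ᶜ ∧ (x d).1 = inf},
        ((x d).2 : Filter D) ≤ cofinite := by
      rintro d ⟨hd, hi⟩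
      rcases (x d).2.le_cofinite_or_eq_pure with h | ⟨a, ha⟩
      · exact h
      · exact absurd ⟨a, Prod.ext hi ha⟩ (hx d hd).1
    obtain ⟨A, hAs, hA, hAn⟩ := exists_diag hinf (fun d => (x d).2) hnp
    obtain ⟨U, hU, hUA⟩ := exists_nonprincipal hA
    obtain ⟨v, _, hv⟩ := isCompact_univ.ultrafilter_le_nhds (U.map fun d => (x d).2) (by simp)
    replace hv : Tendsto (fun d => (x d).2) U (𝓝 v) := hv
    have hclosed : ∀ (B : Set D), (∀ d ∈ A, B ∈ (x d).2) → B ∈ v := by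
      intro B hB
      refine (ultrafilter_isClosed_basic B).mem_of_tendsto hv ?_
      filter_upwards [hUA] with d hd using hB d hd
    have hvA : Aᶜ ∈ v := hclosed _ fun d hd => Ultrafilter.compl_mem_iff_notMem.2 (hAn d hd)
    have hvn : (v : Filter D) ≤ cofinite := by
      rcases v.le_cofinite_or_eq_pure with h | ⟨a, ha⟩
      · exact h
      · have : ({a}ᶜ : Set D) ∈ v := hclosed _ fun d hd => hnp d (hAs hd) (by simp)
        rw [ha] at this
        simp at this
    have hlim : Tendsto (fun d => F (x d)) U (𝓝 (F (inf, v))) := by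
      refine (hF (inf, v) (notMem_Del hvn)).tendsto.comp ?_
      rw [tendsto_nhdsWithin_iff]
      constructor
      · have : Tendsto (fun d => (inf, (x d).2)) U (𝓝 (inf, v)) :=
          tendsto_const_nhds.prodMk_nhds hv
        refine this.congr' ?_
        filter_upwards [hUA] with d hd
        exact Prod.ext (hAs hd).2.symm rfl
      · filter_upwards [hUA] with d hd
        exact (hx d (hAs hd).1).1
    have heq : F (inf, U) = F (inf, v) := by
      refine tendsto_nhds_unique (hT U hU) (hlim.congr' ?_)
      filter_upwards [hUA] with d hd
      exact (hx d (hAs hd).1).2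
    have h2 : U = v := (Prod.ext_iff.1 (hFi (notMem_Del hU) (notMem_Del hvn) heq)).2
    rw [← h2] at hvA
    exact Ultrafilter.compl_mem_iff_notMem.1 hvA hUA

end main

/-- The underlying set of the example. -/
def XS (_τ : Cardinal.{u}) (P D : Type u) (_inf : P) : Type u := P × Ultrafilter D

instance instTopXS (τ : Cardinal.{u}) [hτ : Fact (ℵ₀ ≤ τ)] (P D : Type u) [TopologicalSpace P]
    (inf : P) : TopologicalSpace (XS τ P D inf) where
  IsOpen O := ∀ x ∈ O, x ∉ Del (D := D) inf → ∃ V : Set (P × Ultrafilter D), IsOpen V ∧ x ∈ V ∧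
    ∃ S : Set (P × Ultrafilter D), #S ≤ τ ∧ S ⊆ Del inf ∧ V \ S ⊆ O
  isOpen_univ := fun x _ _ => ⟨Set.univ, isOpen_univ, trivial, ∅, by simp, by simp,
    fun _ _ => trivial⟩
  isOpen_inter := by
    intro s t hs ht x hx hxd
    obtain ⟨V, hV, hxV, S, hS, hSd, hVS⟩ := hs x hx.1 hxd
    obtain ⟨V', hV', hxV', S', hS', hSd', hVS'⟩ := ht x hx.2 hxd
    refine ⟨V ∩ V', hV.inter hV', ⟨hxV, hxV'⟩, S ∪ S',
      (mk_union_le _ _).trans (add_le_of_le hτ.out hS hS'), union_subset hSd hSd', ?_⟩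
    rintro y ⟨⟨h1, h2⟩, h3⟩
    exact ⟨hVS ⟨h1, fun h => h3 (Or.inl h)⟩, hVS' ⟨h2, fun h => h3 (Or.inr h)⟩⟩
  isOpen_sUnion := by
    intro s hs x hx hxd
    obtain ⟨t, ht, hxt⟩ := hx
    obtain ⟨V, hV, hxV, S, hS, hSd, hVS⟩ := hs t ht x hxt hxd
    exact ⟨V, hV, hxV, S, hS, hSd, hVS.trans (subset_sUnion_of_mem ht)⟩

section pass

set_option linter.unusedSectionVars false

variable {τ : Cardinal.{u}} [hτ : Fact (ℵ₀ ≤ τ)] {P D : Type u} [TopologicalSpace P] {inf : P}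

theorem XS_isOpen_iff {O : Set (XS τ P D inf)} :
    IsOpen O ↔ ∀ x ∈ O, x ∉ Del (D := D) inf → ∃ V : Set (P × Ultrafilter D), IsOpen V ∧ x ∈ V ∧
      ∃ S : Set (P × Ultrafilter D), #S ≤ τ ∧ S ⊆ Del inf ∧ V \ S ⊆ O := Iff.rfl

/-- Identity map to the product. -/
def XS.toProd (x : XS τ P D inf) : P × Ultrafilter D := x

theorem XS.continuous_toProd : Continuous (XS.toProd : XS τ P D inf → P × Ultrafilter D) := by
  constructor
  intro V hV
  rw [XS_isOpen_iff]
  intro x hx _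
  exact ⟨V, hV, hx, ∅, by simp, by simp, fun y hy => hy.1⟩

theorem mk_Del : #(Del (D := D) inf) = #D := by
  have : Del (D := D) inf = range (fun d : D => (inf, (pure d : Ultrafilter D))) := by
    ext x; simp [Del, eq_comm]
  rw [this, mk_range_eq]
  intro a b hab
  exact Ultrafilter.pure_injective (Prod.ext_iff.1 hab).2

theorem XS_almost [CompactSpace P] [T2Space P] (hD : #D = Order.succ τ) :
    AlmostStrictATauSubcompact τ (XS τ P D inf) := by
  classical
  intro C hC
  let C' : Set (P × Ultrafilter D) := C
  have hC' : #C' ≤ τ := hC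
  have h1 : τ ≤ #(Del (D := D) inf \ C' : Set _) := by
    by_contra h
    have h2 : #(Del (D := D) inf) ≤ τ := by
      refine (mk_le_mk_of_subset (show Del (D := D) inf ⊆ (Del inf \ C') ∪ C' by
        rw [sdiff_union_self]; exact subset_union_left)).trans ?_
      exact (mk_union_le _ _).trans (add_le_of_le hτ.out (not_le.1 h).le hC')
    rw [mk_Del, hD] at h2
    exact absurd h2 (not_le.2 (Order.lt_succ τ))
  obtain ⟨E, hEs, hE⟩ := le_mk_iff_exists_subset.1 h1
  have h3 : #E = #(E ∪ C' : Set _) := by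
    apply le_antisymm (mk_le_mk_of_subset subset_union_left)
    rw [hE]
    exact (mk_union_le _ _).trans (add_le_of_le hτ.out hE.le hC')
  obtain ⟨ψ⟩ := Cardinal.eq.1 h3
  let g : XS τ P D inf → P × Ultrafilter D := fun x => if h : x ∈ E then ψ ⟨x, h⟩ else x
  have gE : ∀ x (h : x ∈ E), g x = ψ ⟨x, h⟩ := fun x h => dif_pos h
  have gN : ∀ x, x ∉ E → g x = x := fun x h => dif_neg h
  refine ⟨P × Ultrafilter D, inferInstance, inferInstance, inferInstance, g, ?_, ?_, ?_⟩
  · constructor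
    intro V hV
    rw [XS_isOpen_iff]
    intro x hx hxd
    have hxE : x ∉ E := fun h => hxd (hEs h).1
    refine ⟨V, hV, ?_, E, hE.le, fun y hy => (hEs hy).1, ?_⟩
    · have := gN x hxE
      change g x ∈ V at hx
      rwa [this] at hx
    · rintro y ⟨hy, hyE⟩
      change g y ∈ V
      rwa [gN y hyE]
  · rintro ⟨x, hx⟩ ⟨y, hy⟩ hxy
    change g x = g y at hxy
    apply Subtype.ext
    change x = y
    by_cases hxE : x ∈ E <;> by_cases hyE : y ∈ E
    · rw [gE x hxE, gE y hyE] at hxy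
      exact congrArg Subtype.val (ψ.injective (Subtype.ext hxy))
    · rw [gE x hxE, gN y hyE] at hxy
      have := (ψ ⟨x, hxE⟩).2
      rw [hxy] at this
      exact (this.elim hyE hy).elim
    · rw [gN x hxE, gE y hyE] at hxy
      have := (ψ ⟨y, hyE⟩).2
      rw [← hxy] at this
      exact (this.elim hxE hx).elim
    · rwa [gN x hxE, gN y hyE] at hxy
  · intro y
    by_cases hy : y ∈ E ∪ C'
    · refine ⟨⟨(ψ.symm ⟨y, hy⟩).1, (hEs (ψ.symm ⟨y, hy⟩).2).2⟩, ?_⟩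
      change g _ = y
      rw [gE _ (ψ.symm ⟨y, hy⟩).2]
      simp
    · refine ⟨⟨y, fun h => hy (Or.inr h)⟩, ?_⟩
      exact gN y fun h => hy (Or.inl h)

/-- Restriction of a continuous map to the non-exceptional part. -/
theorem XS_continuousOn {Y : Type u} [TopologicalSpace Y] {F : P × Ultrafilter D → Y}
    (hF : Continuous (fun x : XS τ P D inf => F x)) : ContinuousOn F (Del inf)ᶜ := by
  rw [continuousOn_iff]
  intro x hx t ht hxt
  obtain ⟨V, hV, hxV, S, _, hSd, hVS⟩ := XS_isOpen_iff.1 (ht.preimage hF) x hxt hx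
  exact ⟨V, hV, hxV, fun y hy => hVS ⟨hy.1, fun h => hy.2 (hSd h)⟩⟩

theorem XS_uniform {Y : Type u} [TopologicalSpace Y] {F : P × Ultrafilter D → Y}
    (hF : Continuous (fun x : XS τ P D inf => F x)) (U : Ultrafilter D)
    (hU : ∀ A : Set D, #A ≤ τ → Aᶜ ∈ U) :
    Tendsto (fun d => F (inf, pure d)) U (𝓝 (F (inf, U))) := by
  have hUc : (U : Filter D) ≤ cofinite := by
    intro A hA
    have := hU Aᶜ ((lt_aleph0_iff_set_finite.2 hA).le.trans hτ.out)
    simpa using this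
  rw [tendsto_nhds]
  intro O hO hx
  obtain ⟨V, hV, hxV, S, hS, hSd, hVS⟩ :=
    XS_isOpen_iff.1 (hO.preimage hF) (inf, U) hx (notMem_Del hUc)
  have h1 : {d | (inf, (pure d : Ultrafilter D)) ∈ V} ∈ (U : Filter D) :=
    (tendsto_const_nhds.prodMk_nhds (Ultrafilter.tendsto_pure_self U)) (hV.mem_nhds hxV)
  have h2 : ({d | (inf, (pure d : Ultrafilter D)) ∈ S}ᶜ) ∈ (U : Filter D) := by
    apply hU
    refine (mk_preimage_of_injective (fun d : D => (inf, (pure d : Ultrafilter D))) S ?_).trans hS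
    intro a b hab
    exact Ultrafilter.pure_injective (Prod.ext_iff.1 hab).2
  filter_upwards [h1, h2] with d hd hd2
  exact hVS ⟨hd, hd2⟩

/-- A large set on which a finite-to-one fixed-point-free map is disjoint from its image. -/
theorem exists_disjoint {M : Set D} (hM : τ < #M) (φ : D → D) (hφ : ∀ d ∈ M, φ d ≠ d)
    (hfin : ∀ e, (M ∩ φ ⁻¹' {e}).Finite) : ∃ A ⊆ M, τ < #A ∧ ∀ a ∈ A, φ a ∉ A := by
  obtain ⟨A, hA⟩ := zorn_subset {A : Set D | A ⊆ M ∧ ∀ a ∈ A, φ a ∉ A} (by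
    intro c hc hch
    refine ⟨⋃₀ c, ⟨sUnion_subset fun s hs => (hc hs).1, ?_⟩, fun s hs => subset_sUnion_of_mem hs⟩
    rintro a ⟨s, hs, has⟩ ⟨t, ht, hat⟩
    rcases hch.total hs ht with h | h
    · exact (hc ht).2 a (h has) hat
    · exact (hc hs).2 a has (h hat))
  refine ⟨A, hA.prop.1, ?_, hA.prop.2⟩
  by_contra hAτ
  rw [not_lt] at hAτ
  have hsub : M ⊆ A ∪ φ '' A ∪ ⋃ e ∈ A, M ∩ φ ⁻¹' {e} := by
    intro d hd
    by_contra hn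
    simp only [mem_union, not_or, mem_iUnion, not_exists] at hn
    obtain ⟨⟨hn1, hn2⟩, hn3⟩ := hn
    have : insert d A ⊆ A := by
      refine hA.le_of_ge (y := insert d A) ⟨insert_subset hd hA.prop.1, ?_⟩ (subset_insert _ _)
      rintro a (rfl | ha) (h | h)
      · exact hφ _ hd h
      · exact hn3 _ h ⟨hd, rfl⟩
      · exact hn2 ⟨a, ha, h⟩
      · exact hA.prop.2 a ha h
    exact hn1 (this (mem_insert _ _))
  have h3 : #(⋃ e ∈ A, M ∩ φ ⁻¹' {e} : Set D) ≤ τ := by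
    refine (mk_biUnion_le _ _).trans (mul_le_of_le hτ.out hAτ ?_)
    refine ciSup_le' fun e => ?_
    exact (lt_aleph0_iff_set_finite.2 (hfin e)).le.trans hτ.out
  have := (mk_le_mk_of_subset hsub).trans ((mk_union_le _ _).trans (add_le_of_le hτ.out
    ((mk_union_le _ _).trans (add_le_of_le hτ.out hAτ (mk_image_le.trans hAτ))) h3))
  exact absurd this (not_le.2 hM)

variable [CompactSpace P] [T2Space P]

theorem XS_pass1 {Y : Type u} [TopologicalSpace Y] [CompactSpace Y] [T2Space Y]
    {V : Ultrafilter P} (hV : (V : Filter P) ≤ 𝓝[≠] inf)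
    (hP : ∀ S : Set P, S.Countable → inf ∉ S → ∃ K : Set P, IsClosed K ∧ inf ∉ K ∧ S ⊆ K)
    {F : P × Ultrafilter D → Y} (hF : Continuous (fun x : XS τ P D inf => F x))
    (hFb : Function.Bijective F) :
    ∃ B : Set D, #B ≤ τ ∧ ∀ d ∉ B,
      Tendsto (fun p => F (p, pure d)) V (𝓝 (F (inf, pure d))) := by
  obtain ⟨H, hH⟩ := exists_H V F
  have hFc := XS_continuousOn hF
  have hFi : InjOn F (Del inf)ᶜ := hFb.1.injOn
  have hT := H_tendsto hV hFc hH
  have hfib := H_fiber hFi hT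
  have hfin := H_finite hP hFc hFi hT
  refine ⟨{d | H d ≠ F (inf, pure d)}, ?_, fun d hd => by
    have : H d = F (inf, pure d) := not_not.1 hd
    rw [← this]; exact hH d⟩
  by_contra hB
  rw [not_le] at hB
  have hex : ∀ d, ∃ e, H d ∉ F '' (Del inf)ᶜ → H d = F (inf, pure e) := by
    intro d
    by_cases h : H d ∈ F '' (Del inf)ᶜ
    · exact ⟨d, fun h' => absurd h h'⟩
    · obtain ⟨x, hx⟩ := hFb.2 (H d)
      have : x ∈ Del inf := by
        by_contra hxd
        exact h ⟨x, hxd, hx⟩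
      obtain ⟨e, he⟩ := this
      exact ⟨e, fun _ => by rw [← he, hx]⟩
  choose φ hφ using hex
  let M : Set D := {d | H d ≠ F (inf, pure d)} \ {d | H d ∈ F '' (Del inf)ᶜ}
  have hM : τ < #M := by
    by_contra h
    rw [not_lt] at h
    refine absurd hB (not_lt.2 ?_)
    refine (mk_le_mk_of_subset (show _ ⊆ M ∪ {d | H d ∈ F '' (Del inf)ᶜ} by
      rw [sdiff_union_self]; exact subset_union_left)).trans ?_
    exact (mk_union_le _ _).trans (add_le_of_le hτ.out h
      ((lt_aleph0_iff_set_finite.2 hfin).le.trans hτ.out))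
  have hMφ : ∀ d ∈ M, H d = F (inf, pure (φ d)) := fun d hd => hφ d hd.2
  have hff : ∀ e, (M ∩ φ ⁻¹' {e}).Finite := by
    intro e
    refine (hfib (F (inf, pure e))).subset ?_
    rintro d ⟨hd, rfl⟩
    exact hMφ d hd
  obtain ⟨A, hAM, hA, hAd⟩ := exists_disjoint hM φ (fun d hd h => hd.1 (by
    have := hMφ d hd
    rwa [h] at this)) hff
  have hreg := isRegular_succ hτ.out
  have hne : (cocardinal D hreg ⊓ 𝓟 A).NeBot :=
    cocardinal_inf_principal_neBot_iff.2 (Order.succ_le_of_lt hA)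
  let U := Ultrafilter.of (cocardinal D hreg ⊓ 𝓟 A)
  have hUA : A ∈ U := le_principal_iff.1 ((Ultrafilter.of_le _).trans inf_le_right)
  have hU : ∀ S : Set D, #S ≤ τ → Sᶜ ∈ U := by
    intro S hS
    have : (U : Filter D) ≤ cocardinal D hreg := (Ultrafilter.of_le _).trans inf_le_left
    exact this (compl_mem_cocardinal_of_card_lt (Order.lt_succ_iff.2 hS))
  have hU' : ∀ S : Set D, #S ≤ τ → Sᶜ ∈ U.map φ := by
    intro S hS
    have h3 : #(⋃ e ∈ S, M ∩ φ ⁻¹' {e} : Set D) ≤ τ := by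
      refine (mk_biUnion_le _ _).trans (mul_le_of_le hτ.out hS ?_)
      refine ciSup_le' fun e => ?_
      exact (lt_aleph0_iff_set_finite.2 (hff e)).le.trans hτ.out
    rw [Ultrafilter.mem_map]
    refine mem_of_superset (inter_mem (f := (U : Filter D)) (hU _ h3) hUA) ?_
    rintro d ⟨hd, hdA⟩ hdS
    exact hd (mem_biUnion hdS ⟨hAM hdA, rfl⟩)
  have hcof : ∀ W : Ultrafilter D, (∀ S : Set D, #S ≤ τ → Sᶜ ∈ W) → (W : Filter D) ≤ cofinite := by
    intro W hW S hS
    have := hW Sᶜ ((lt_aleph0_iff_set_finite.2 hS).le.trans hτ.out)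
    simpa using this
  have t1 := hT U (hcof U hU)
  have t2 : Tendsto (fun d => F (inf, pure (φ d))) U (𝓝 (F (inf, U.map φ))) :=
    (XS_uniform hF (U.map φ) hU').comp (show Tendsto φ U (U.map φ) from tendsto_map)
  have heq : F (inf, U) = F (inf, U.map φ) := by
    refine tendsto_nhds_unique t1 (t2.congr' ?_)
    filter_upwards [hUA] with d hd
    exact (hMφ d (hAM hd)).symm
  have h2 : U = U.map φ := (Prod.ext_iff.1 (hFb.1 heq)).2
  have h4 : A ∈ U.map φ := h2 ▸ hUA
  rw [Ultrafilter.mem_map] at h4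
  obtain ⟨d, hd1, hd2⟩ := U.neBot.nonempty_of_mem (inter_mem (f := (U : Filter D)) h4 hUA)
  exact hAd d hd2 hd1

theorem XS_not_aTau (hD : #D = Order.succ τ) (hne : (𝓝[≠] inf).NeBot)
    (hP : ∀ S : Set P, S.Countable → inf ∉ S → ∃ K : Set P, IsClosed K ∧ inf ∉ K ∧ S ⊆ K) :
    ¬ ATauSubcompact τ (XS τ P D inf) := by
  classical
  intro hX
  obtain ⟨Y, _, ⟨hYc, hY2, hYa⟩, f, hf, hfb⟩ := hX ∅ (by simp)
  let F : P × Ultrafilter D → Y := fun x => f ⟨x, fun h => h⟩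
  have hF : Continuous (fun x : XS τ P D inf => F x) :=
    hf.comp (Continuous.subtype_mk continuous_id _)
  have hFb : Function.Bijective F := by
    constructor
    · intro x y hxy
      exact congrArg Subtype.val (hfb.1 hxy)
    · intro y
      obtain ⟨x, hx⟩ := hfb.2 y
      exact ⟨x.1, hx⟩
  let V : Ultrafilter P := Ultrafilter.of (𝓝[≠] inf)
  have hV : (V : Filter P) ≤ 𝓝[≠] inf := Ultrafilter.of_le _
  obtain ⟨B, hB, hBt⟩ := XS_pass1 hV hP hF hFb
  have hBc : (Bᶜ : Set D).Infinite := by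
    intro hfin
    have h1 : #D ≤ τ := by
      rw [← mk_univ, ← union_compl_self B]
      exact (mk_union_le _ _).trans (add_le_of_le hτ.out hB
        ((lt_aleph0_iff_set_finite.2 hfin).le.trans hτ.out))
    rw [hD] at h1
    exact absurd h1 (not_le.2 (Order.lt_succ τ))
  have := hBc.to_subtype
  let N : Set D := range fun n => ((Infinite.natEmbedding (Bᶜ : Set D) n : (Bᶜ : Set D)) : D)
  have hNi : N.Infinite := infinite_range_of_injective
    (Subtype.val_injective.comp (Infinite.natEmbedding _).injective)
  have hNc : #N ≤ τ := (le_aleph0_iff_set_countable.2 (countable_range _)).trans hτ.out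
  let C : Set Y := (fun d : D => F (inf, pure d)) '' (B ∪ N)
  have hC : #C ≤ τ := mk_image_le.trans ((mk_union_le _ _).trans (add_le_of_le hτ.out hB hNc))
  obtain ⟨Z, _, hZc, hZ2, k, hk, hkb⟩ := hYa C hC
  have hdelC : ∀ x ∈ (Del (D := D) inf)ᶜ, F x ∈ Cᶜ := by
    rintro x hx ⟨d, _, hd⟩
    exact hx ⟨d, (hFb.1 hd).symm⟩
  have hpC : ∀ d ∉ B ∪ N, F (inf, pure d) ∈ Cᶜ := by
    rintro d hd ⟨e, he, hed⟩
    have := Ultrafilter.pure_injective (Prod.ext_iff.1 (hFb.1 hed)).2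
    exact hd (this ▸ he)
  obtain ⟨U0, hU0, _⟩ := exists_nonprincipal hNi
  let z0 : Z := k ⟨F (inf, U0), hdelC _ (notMem_Del hU0)⟩
  let G : P × Ultrafilter D → Z := fun x => if h : F x ∈ Cᶜ then k ⟨F x, h⟩ else z0
  have hG : ∀ x (h : F x ∈ Cᶜ), G x = k ⟨F x, h⟩ := fun x h => dif_pos h
  have hGc : ContinuousOn G (Del inf)ᶜ := by
    rw [continuousOn_iff_continuous_domRestrict]
    have h1 : (Del (D := D) inf)ᶜ.domRestrict G =
        fun x => k ⟨F x.1, hdelC x.1 x.2⟩ := by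
      ext x
      exact hG _ _
    rw [h1]
    exact hk.comp ((continuousOn_iff_continuous_domRestrict.1 (XS_continuousOn hF)).subtype_mk _)
  have hGi : InjOn G (Del inf)ᶜ := by
    intro x hx y hy hxy
    rw [hG x (hdelC x hx), hG y (hdelC y hy)] at hxy
    exact hFb.1 (congrArg Subtype.val (hkb.1 hxy))
  obtain ⟨H, hH⟩ := exists_H V G
  have hT := H_tendsto hV hGc hH
  have hfib := H_fiber hGi hT
  have hfin := H_finite hP hGc hGi hT
  have hVne : ({inf}ᶜ : Set P) ∈ (V : Filter P) := hV self_mem_nhdsWithin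
  have hHe : ∀ e ∉ B ∪ N, H e = G (inf, pure e) := by
    intro e he
    refine tendsto_nhds_unique (hH e) ?_
    rw [hG _ (hpC e he)]
    have hin : ∀ᶠ p in (V : Filter P), F (p, pure e) ∈ Cᶜ := by
      filter_upwards [hVne] with p hp
      apply hdelC
      rintro ⟨d, hd⟩
      exact hp (Prod.ext_iff.1 hd).1
    have ht := hBt e (fun h => he (Or.inl h))
    rw [tendsto_nhds]
    intro O hO hmem
    obtain ⟨O', hO', hOO⟩ := isOpen_induced_iff.1 (hO.preimage hk)
    have hm' : F (inf, pure e) ∈ O' := by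
      have : (⟨F (inf, pure e), hpC e he⟩ : (Cᶜ : Set Y)) ∈ Subtype.val ⁻¹' O' := by
        rw [hOO]; exact hmem
      exact this
    filter_upwards [hin, ht (hO'.mem_nhds hm')] with p hp hp'
    change G (p, pure e) ∈ O
    rw [hG _ hp]
    have : (⟨F (p, pure e), hp⟩ : (Cᶜ : Set Y)) ∈ k ⁻¹' O := by
      rw [← hOO]; exact hp'
    exact this
  let N1 : Set D := N \ {d | H d ∈ G '' (Del inf)ᶜ}
  have hN1 : N1.Infinite := hNi.sdiff hfin
  have hex : ∀ n, ∃ e, n ∈ N1 → e ∉ B ∪ N ∧ H n = H e := by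
    intro n
    by_cases hn : n ∈ N1
    · obtain ⟨⟨y, hy⟩, hyk⟩ := hkb.2 (H n)
      obtain ⟨x, rfl⟩ := hFb.2 y
      have hGx : G x = H n := (hG x hy).trans hyk
      have hxd : x ∈ Del inf := by
        by_contra hxd
        exact hn.2 ⟨x, hxd, hGx⟩
      obtain ⟨e, rfl⟩ := hxd
      have he : e ∉ B ∪ N := fun h => hy ⟨e, h, rfl⟩
      exact ⟨e, fun _ => ⟨he, by rw [hHe e he, hGx]⟩⟩
    · exact ⟨n, fun h => absurd h hn⟩
  choose ψ hψ using hex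
  obtain ⟨U, hU, hUN⟩ := exists_nonprincipal hN1
  have hU' : (U.map ψ : Filter D) ≤ cofinite := by
    rcases (U.map ψ).le_cofinite_or_eq_pure with h | ⟨a, ha⟩
    · exact h
    · exfalso
      have h1 : {a} ∈ U.map ψ := by rw [ha]; simp
      rw [Ultrafilter.mem_map] at h1
      have h2 : (N1 ∩ ψ ⁻¹' {a}).Finite := by
        refine (hfib (H a)).subset ?_
        rintro d ⟨hd, hda⟩
        have hda' : ψ d = a := hda
        have := (hψ d hd).2
        rw [hda'] at this
        exact this
      have h3 : (N1 ∩ ψ ⁻¹' {a})ᶜ ∈ (U : Filter D) := hU h2.compl_mem_cofinite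
      obtain ⟨d, hd1, hd2⟩ := U.neBot.nonempty_of_mem
        (inter_mem (inter_mem (f := (U : Filter D)) hUN h1) h3)
      exact hd2 hd1
  have t2 : Tendsto (fun d => H (ψ d)) U (𝓝 (G (inf, U.map ψ))) :=
    (hT (U.map ψ) hU').comp (show Tendsto ψ U (U.map ψ) from tendsto_map)
  have heq : G (inf, U) = G (inf, U.map ψ) := by
    refine tendsto_nhds_unique (hT U hU) (t2.congr' ?_)
    filter_upwards [hUN] with d hd
    exact (hψ d hd).2.symm
  have h2 : U = U.map ψ := (Prod.ext_iff.1 (hGi (notMem_Del hU) (notMem_Del hU') heq)).2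
  have h4 : N1 ∈ U.map ψ := h2 ▸ hUN
  rw [Ultrafilter.mem_map] at h4
  obtain ⟨d, hd1, hd2⟩ := U.neBot.nonempty_of_mem (inter_mem (f := (U : Filter D)) h4 hUN)
  exact (hψ d hd2).1 (Or.inr hd1.1)

end pass

theorem stmt_2_aux (τ : Cardinal.{u}) (hτ : ℵ₀ ≤ τ) :
    ∃ (X : Type u) (_ : TopologicalSpace X), T2Space X ∧
      AlmostStrictATauSubcompact τ X ∧ ¬ ATauSubcompact τ X := by
  have : Fact (ℵ₀ ≤ τ) := ⟨hτ⟩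
  let D : Type u := (Order.succ τ).out
  have hD : #D = Order.succ τ := mk_out _
  have hDu : Uncountable D := by
    rw [← aleph0_lt_mk_iff, hD]
    exact hτ.trans_lt (Order.lt_succ τ)
  obtain ⟨P, _, inf, hPc, hP2, hne, hP⟩ := exists_P D hDu
  refine ⟨XS τ P D inf, inferInstance, ?_, XS_almost hD, XS_not_aTau hD hne hP⟩
  exact T2Space.of_injective_continuous (f := (XS.toProd : XS τ P D inf → P × Ultrafilter D))
    (fun _ _ h => h) XS.continuous_toProd

end helpers

/-- for every infinite cardinal `τ` there is a Hausdorff space that is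
almost strictly `a_τ`-subcompact but not `a_τ`-subcompact. -/
theorem stmt_2 (τ : Cardinal.{u}) (hτ : ℵ₀ ≤ τ) :
    ∃ (X : Type u) (_ : TopologicalSpace X), T2Space X ∧
      AlmostStrictATauSubcompact τ X ∧ ¬ ATauSubcompact τ X := by
  exact stmt_2_aux τ hτ
end

section
/- Let τ be an infinite cardinal, let {X_β : β ∈ B} be a family of compact Hausdorff spaces, each with more than one point and with density d(X_β) ≤ τ, where |B| ≥ τ⁺ (the successor cardinal of τ), and let p ∈ ∏{X_β : β ∈ B}. Then the Σ_τ-product X = {x ∈ ∏X_β : |{β : x_β ≠ p_β}| ≤ τ}, with the subspace topology of the product, is not subcompact, i.e., X admits no condensation onto a compact Hausdorff space. -/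
open Cardinal Topology

universe u

section helpers
open Filter Set

open Classical in
/-- indicator of a finset -/
noncomputable def finInd {ι : Type*} (u : Finset ι) : ι → Bool := fun i => decide (i ∈ u)

theorem ext_aux {ι Y : Type*} [TopologicalSpace Y] [CompactSpace Y] [T2Space Y]
    (E : Set (ι → Bool)) (hE : ∀ s : ι → Bool, {i | s i = true}.Countable → s ∈ E)
    (k : E → Y) (hk : Continuous k) :
    ∃ F : (ι → Bool) → Y, Continuous F ∧ ∀ s : E, F s = k s := by
  classical
  have hfin : ∀ u : Finset ι, finInd u ∈ E := fun u => hE _ (by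
    simpa [finInd] using u.countable_toSet)
  -- approximations of a point of E by finite supports
  have happ : ∀ (z : ι → Bool) (y : Y) (N : Set Y), IsOpen N → y ∈ N →
      ClusterPt y (map k (comap Subtype.val (𝓝 z))) → ∀ A : Finset ι,
      ∃ u : Finset ι, (∀ i ∈ A, finInd u i = z i) ∧ k ⟨finInd u, hfin u⟩ ∈ N := by
    intro z y N hN hy hc A
    have hfr : ∃ᶠ y' in map k (comap Subtype.val (𝓝 z)), y' ∈ N :=
      hc.frequently (hN.mem_nhds hy)
    rw [frequently_map] at hfr
    have hopen : ∀ z : ι → Bool, ∀ᶠ s : ι → Bool in 𝓝 z, ∀ i ∈ A, s i = z i := by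
      intro z
      rw [Filter.eventually_all_finset]
      intro i _
      exact ((continuous_apply (A := fun _ : ι => Bool) i).tendsto z).eventually (p := fun t => t = z i) (by rw [nhds_discrete]; exact rfl)
    obtain ⟨s, hs1, hs2⟩ := (hfr.and_eventually ((hopen z).comap Subtype.val)).exists
    have ht : Tendsto (fun u : Finset ι =>
        (⟨finInd (u.filter (fun i => s.1 i = true)), hfin _⟩ : E)) atTop (𝓝 s) := by
      rw [tendsto_subtype_rng, tendsto_pi_nhds]
      intro i
      refine tendsto_const_nhds.congr' ?_
      filter_upwards [eventually_ge_atTop {i}] with u hu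
      have : i ∈ u := hu (by simp)
      simp [finInd, this]
    have h1 := ht.eventually (hk.continuousAt.eventually (hN.mem_nhds hs1))
    have h2 := ht.eventually (continuous_subtype_val.continuousAt.eventually (hopen s.1))
    obtain ⟨u, hu1, hu2⟩ := (h1.and h2).exists
    exact ⟨_, fun i hi => (hu2 i hi).trans (hs2 i hi), hu1⟩
  have hdense : DenseRange (Subtype.val : E → ι → Bool) := by
    intro z
    refine mem_closure_of_tendsto (b := atTop) (f := fun u : Finset ι =>
      finInd (u.filter (fun i => z i = true))) ?_ (Eventually.of_forall fun u => ⟨⟨_, hfin _⟩, rfl⟩)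
    rw [tendsto_pi_nhds]
    intro i
    refine tendsto_const_nhds.congr' ?_
    filter_upwards [eventually_ge_atTop {i}] with u hu
    have : i ∈ u := hu (by simp)
    simp [finInd, this]
  have hdi : IsDenseInducing (Subtype.val : E → ι → Bool) :=
    ⟨Topology.IsInducing.subtypeVal, hdense⟩
  have huniq : ∀ (z : ι → Bool) (y y' : Y),
      ClusterPt y (map k (comap Subtype.val (𝓝 z))) →
      ClusterPt y' (map k (comap Subtype.val (𝓝 z))) → y = y' := by
    intro z y y' hy hy'
    by_contra hne
    obtain ⟨N, hyN, hN, N', hyN', hN', hd⟩ := exists_open_nhds_disjoint_closure hne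
    choose u hu1 hu2 using happ z y N hN hyN hy
    choose u' hu1' hu2' using happ z y' N' hN' hyN' hy'
    let A : ℕ → Finset ι := fun n => Nat.rec (motive := fun _ => Finset ι) ∅ (fun _ a => a ∪ u a ∪ u' a) n
    have hAs : ∀ n, A (n+1) = A n ∪ u (A n) ∪ u' (A n) := fun n => rfl
    have hmono : Monotone A := monotone_nat_of_le_succ (fun n => by
      rw [hAs]; intro i hi; simp [hi])
    let w : ι → Bool := fun i => decide (∃ n : ℕ, i ∈ A n) && z i
    have hw : w ∈ E := hE _ ((countable_iUnion fun n => (A n).countable_toSet).mono (by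
      intro i hi
      simp only [w, mem_ofPred_eq, Bool.and_eq_true, decide_eq_true_eq] at hi
      simpa using hi.1))
    have key : ∀ v : Finset ι → Finset ι, (∀ a, ∀ i ∈ a, finInd (v a) i = z i) →
        (∀ n, v (A n) ⊆ A (n+1)) →
        Tendsto (fun n => k ⟨finInd (v (A n)), hfin _⟩) atTop (𝓝 (k ⟨w, hw⟩)) := by
      intro v hv hvA
      refine (hk.tendsto _).comp ?_
      rw [tendsto_subtype_rng, tendsto_pi_nhds]
      intro i
      refine tendsto_const_nhds.congr' ?_
      by_cases h : ∃ n, i ∈ A n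
      · obtain ⟨m, hm⟩ := h
        filter_upwards [eventually_ge_atTop m] with n hn
        rw [hv (A n) i (hmono hn hm)]
        have : ∃ n, i ∈ A n := ⟨m, hm⟩
        simp [w, this]
      · refine Eventually.of_forall fun n => ?_
        have h2 : i ∉ v (A n) := fun h' => h ⟨n + 1, hvA n h'⟩
        simp only [w, h, finInd, h2]
        simp
    have k1 := key u hu1 (fun n => by rw [hAs]; intro i hi; simp [hi])
    have k2 := key u' hu1' (fun n => by rw [hAs]; intro i hi; simp [hi])
    exact Set.disjoint_left.1 hd
      (mem_closure_of_tendsto k1 (Eventually.of_forall fun n => hu2 _))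
      (mem_closure_of_tendsto k2 (Eventually.of_forall fun n => hu2' _))
  refine ⟨hdi.extend k, hdi.continuous_extend ?_, fun s => hdi.extend_eq_at hk.continuousAt⟩
  intro z
  have : (comap (Subtype.val : E → ι → Bool) (𝓝 z)).NeBot := hdi.comap_nhds_neBot z
  obtain ⟨c, hc⟩ := exists_clusterPt_of_compactSpace (map k (comap Subtype.val (𝓝 z)))
  exact ⟨c, le_nhds_of_unique_clusterPt fun y hy => huniq z y c hy hc⟩

theorem ulam_aux (τ : Cardinal.{u}) (hτ : ℵ₀ ≤ τ) : ∃ (ι I : Type u) (_ : LinearOrder ι), #ι = Order.succ τ ∧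
    #I = τ ∧ (∀ a : ι, #(Set.Iic a) ≤ τ) ∧
    ∃ g : ι → ι → I, ∀ c a b, a < c → b < c → g c a = g c b → a = b := by
  refine ⟨(Order.succ τ).ord.ToType, τ.out, inferInstance, Cardinal.mk_ord_toType _,
    Cardinal.mk_out _, ?_, ?_⟩
  · intro a
    have h1 : #(Set.Iio a) ≤ τ := Order.lt_succ_iff.1 (Cardinal.mk_Iio_toType_ord_lt a)
    rw [← Set.Iio_insert]
    exact (Cardinal.mk_insert_le).trans (Cardinal.add_le_of_le hτ h1 (Cardinal.one_le_aleph0.trans hτ))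
  · have : ∀ c : (Order.succ τ).ord.ToType, ∃ g : (Order.succ τ).ord.ToType → τ.out,
        Set.InjOn g (Set.Iio c) := by
      intro c
      have h1 : #(Set.Iio c) ≤ #τ.out := by
        rw [Cardinal.mk_out]
        exact Order.lt_succ_iff.1 (Cardinal.mk_Iio_toType_ord_lt c)
      obtain ⟨k⟩ := (Cardinal.le_def _ _).1 h1
      have hne : Nonempty τ.out := by
        rw [← Cardinal.mk_ne_zero_iff, Cardinal.mk_out]
        exact (Cardinal.aleph0_pos.trans_le hτ).ne'
      refine ⟨fun x => if hx : x ∈ Set.Iio c then k ⟨x, hx⟩ else Classical.choice hne, ?_⟩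
      intro x hx y hy hxy
      simp only [dif_pos hx, dif_pos hy] at hxy
      exact congrArg Subtype.val (k.injective hxy)
    choose g hg using this
    exact ⟨g, fun c a b ha hb hab => hg c ha hb hab⟩

/-- a `Σ_τ`-product of at least `τ⁺` many nontrivial compact Hausdorff
spaces of density at most `τ` is not subcompact. -/
theorem stmt_8_aux (τ : Cardinal.{u}) (hτ : ℵ₀ ≤ τ)
    (B : Type u) (hB : Order.succ τ ≤ #B)
    (Xb : B → Type u) [∀ b, TopologicalSpace (Xb b)] [∀ b, CompactSpace (Xb b)]
    [∀ b, T2Space (Xb b)] (hnt : ∀ b, Nontrivial (Xb b))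
    (hd : ∀ b, ∃ s : Set (Xb b), Dense s ∧ #s ≤ τ)
    (p : ∀ b, Xb b) :
    ¬ Subcompact ↥{x : ∀ b, Xb b | #{b | x b ≠ p b} ≤ τ} := by
  classical
  rintro ⟨Y, _, _, _, f, hf, hbij⟩
  obtain ⟨ι, I, _, hι, hI, hIic, g, hg⟩ := ulam_aux τ hτ
  have hιB : #ι ≤ #B := hι ▸ hB
  obtain ⟨e⟩ := (Cardinal.le_def _ _).1 hιB
  choose q hq using fun b => exists_ne (p b)
  let P : (ι → Bool) → ∀ b, Xb b := fun s b => if ∃ i, e i = b ∧ s i = true then q b else p b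
  have hPe : ∀ s i, P s (e i) = if s i = true then q (e i) else p (e i) := by
    intro s i
    simp [P]
  have hPc : Continuous P := by
    refine continuous_pi fun b => ?_
    by_cases h : ∃ i, e i = b
    · obtain ⟨i, rfl⟩ := h
      simp only [hPe]
      exact (continuous_of_discreteTopology
        (f := fun t : Bool => if t = true then q (e i) else p (e i))).comp (continuous_apply i)
    · have : ∀ s, P s b = p b := fun s => if_neg (fun ⟨i, hi, _⟩ => h ⟨i, hi⟩)
      simp only [this]
      exact continuous_const
  let E : Set (ι → Bool) := {s | #{i | s i = true} ≤ τ}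
  have hPE : ∀ s ∈ E, #{b | P s b ≠ p b} ≤ τ := by
    intro s hs
    refine le_trans ?_ (Cardinal.mk_image_le (f := e) (s := {i | s i = true}) |>.trans hs)
    refine Cardinal.mk_le_mk_of_subset ?_
    intro b hb
    by_contra h
    exact hb (if_neg (fun ⟨i, h1, h2⟩ => h ⟨i, h2, h1⟩))
  obtain ⟨F, hF, hFE⟩ := ext_aux E (fun s hs => (Cardinal.le_aleph0_iff_set_countable.2 hs).trans hτ)
    (fun s => f ⟨P s.1, hPE s.1 s.2⟩)
    (hf.comp ((hPc.comp continuous_subtype_val).subtype_mk _))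
  obtain ⟨h, hhf, hfh⟩ := Function.bijective_iff_has_inverse.1 hbij
  -- the key continuity property
  have L : ∀ (J : Type u) (l : Filter J) [l.NeBot] (_ : #J ≤ τ) (v : J → ι → Bool)
      (d : ι → Bool) (_ : Tendsto v l (𝓝 d)) (b : B),
      Tendsto (fun j => (h (F (v j))).1 b) l (𝓝 ((h (F d)).1 b)) := by
    intro J l _ hJ v d hv b
    let A : Set B := ⋃ j, {b | (h (F (v j))).1 b ≠ p b}
    have hA : #A ≤ τ := by
      refine (Cardinal.mk_iUnion_le _).trans ?_
      refine (mul_le_mul' hJ (ciSup_le' fun j => (h (F (v j))).2)).trans ?_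
      exact (Cardinal.mul_eq_self hτ).le
    let XA : Set (∀ b, Xb b) := {x | ∀ b, b ∉ A → x b = p b}
    have hXA : ∀ x ∈ XA, #{b | x b ≠ p b} ≤ τ := fun x hx =>
      (Cardinal.mk_le_mk_of_subset (fun b hb => by
        by_contra h'; exact hb (hx b h'))).trans hA
    have hcl : IsClosed XA := by
      have : XA = ⋂ b, ⋂ (_ : b ∉ A), {x | x b = p b} := by ext; simp [XA]
      rw [this]
      exact isClosed_iInter fun b => isClosed_iInter fun _ =>
        isClosed_eq (continuous_apply b) continuous_const
    have : CompactSpace XA := isCompact_iff_compactSpace.1 hcl.isCompact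
    let m : XA → Y := fun x => f ⟨x.1, hXA x.1 x.2⟩
    have hm : Continuous m := hf.comp (continuous_subtype_val.subtype_mk _)
    have hmi : Function.Injective m := by
      intro x y hxy
      have := hbij.1 hxy
      exact Subtype.ext (congrArg (fun t => t.1) this)
    have hme : IsClosedEmbedding m := hm.isClosedEmbedding hmi
    have hvm : ∀ j, ∃ x : XA, m x = F (v j) ∧ x.1 = (h (F (v j))).1 := by
      intro j
      refine ⟨⟨(h (F (v j))).1, fun b hb => ?_⟩, hfh _, rfl⟩
      by_contra h'
      exact hb (mem_iUnion.2 ⟨j, h'⟩)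
    choose x hx hx' using hvm
    have hFv : Tendsto (fun j => F (v j)) l (𝓝 (F d)) := (hF.tendsto d).comp hv
    have hmem : F d ∈ range m := hme.isClosed_range.mem_of_tendsto hFv
      (Eventually.of_forall fun j => ⟨x j, hx j⟩)
    obtain ⟨x0, hx0⟩ := hmem
    have hx0' : x0.1 = (h (F d)).1 := by
      rw [← hx0, hhf]
    have ht : Tendsto x l (𝓝 x0) := by
      rw [hme.isInducing.tendsto_nhds_iff, hx0]
      refine hFv.congr fun j => (hx j).symm
    have := (((continuous_apply b).comp continuous_subtype_val).tendsto x0).comp ht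
    rw [← hx0']
    refine this.congr fun j => ?_
    simp [hx']
  have hhE : ∀ s ∈ E, ∀ i, (h (F s)).1 (e i) = if s i = true then q (e i) else p (e i) := by
    intro s hs i
    rw [hFE ⟨s, hs⟩, hhf]
    exact hPe s i
  let one : ι → Bool := fun _ => true
  obtain ⟨i0, hi0⟩ : ∃ i, (h (F one)).1 (e i) = p (e i) := by
    by_contra! hcon
    have h1 : #ι ≤ τ := by
      have h0 : #{b | (h (F one)).1 b ≠ p b} ≤ τ := (h (F one)).2
      refine le_trans ?_ h0
      exact Cardinal.mk_le_of_injective (f := fun i => ⟨e i, hcon i⟩)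
        (fun i j hij => e.injective (congrArg Subtype.val hij))
    rw [hι] at h1
    exact absurd (Order.lt_succ τ) (not_lt.2 h1)
  obtain ⟨O, O', hO, hO', hpO, hqO, hdisj⟩ := t2_separation (hq (e i0)).symm
  let S : ι → Finset I → ι → Bool := fun a u c =>
    if c ≤ a ∨ c = i0 then true else decide (g c a ∈ u)
  have hIinf : Infinite I := by
    rw [Cardinal.infinite_iff, hI]; exact hτ
  have hFinI : #(Finset I) = τ := by rw [Cardinal.mk_finset_of_infinite, hI]
  have step : ∀ a, ∃ u : Finset I, (h (F (S a u))).1 (e i0) ∈ O := by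
    intro a
    have ht : Tendsto (S a) atTop (𝓝 one) := by
      rw [tendsto_pi_nhds]
      intro c
      refine tendsto_const_nhds.congr' ?_
      filter_upwards [eventually_ge_atTop {g c a}] with u hu
      have : g c a ∈ u := hu (by simp)
      simp [S, this, one]
    have := L (Finset I) atTop hFinI.le (S a) one ht (e i0)
    rw [hi0] at this
    exact (this.eventually (hO.mem_nhds hpO)).exists
  choose u hu using step
  obtain ⟨U, hU⟩ : ∃ U, Infinite (u ⁻¹' {U}) := by
    have hlt : #(Finset I) < #ι := by rw [hFinI, hι]; exact Order.lt_succ τ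
    obtain ⟨U, hU⟩ := Cardinal.infinite_pigeonhole_card_lt u hlt
      (by rw [hι]; exact hτ.trans (Order.le_succ τ))
    refine ⟨U, Cardinal.infinite_iff.2 ?_⟩
    rw [hFinI] at hU
    exact hτ.trans hU.le
  let al : ULift.{u} ℕ → ι := fun n => (Infinite.natEmbedding (u ⁻¹' {U}) n.down).1
  have hal : Function.Injective al := fun m n hmn =>
    ULift.ext _ _ ((Infinite.natEmbedding (u ⁻¹' {U})).injective (Subtype.ext hmn))
  have halU : ∀ n, u (al n) = U := fun n => (Infinite.natEmbedding (u ⁻¹' {U}) n.down).2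
  have hN : #(ULift.{u} ℕ) ≤ τ := by simpa using hτ
  let v : ULift.{u} ℕ → ι → Bool := fun n => S (al n) U
  let hyp : Ultrafilter (ULift.{u} ℕ) := hyperfilter _
  obtain ⟨w, -, hw⟩ := isCompact_univ.ultrafilter_le_nhds (hyp.map v) (by simp)
  have hw : Tendsto v hyp (𝓝 w) := hw
  have hwi : ∀ c, ∀ᶠ n in (hyp : Filter _), v n c = w c := fun c =>
    ((tendsto_pi_nhds.1 hw) c).eventually (p := fun t => t = w c) (by rw [nhds_discrete]; exact rfl)
  have hw0 : w i0 = true := by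
    obtain ⟨n, hn⟩ := (hwi i0).exists
    rw [← hn]; simp [v, S]
  have hwE : w ∈ E := by
    have hsub : {c | w c = true} ⊆ (⋃ n, Set.Iic (al n)) ∪ {i0} := by
      intro c hc
      by_contra hcon
      simp only [mem_union, mem_iUnion, mem_Iic, mem_singleton_iff, not_or, not_exists,
        not_le] at hcon
      have hfin : {n | g c (al n) ∈ U}.Finite := by
        refine Set.Finite.preimage (f := fun n => g c (al n)) ?_ U.finite_toSet
        intro m _ n _ hmn
        exact hal (hg c _ _ (hcon.1 m) (hcon.1 n) hmn)
      have h2 : ∀ᶠ n in (hyp : Filter _), n ∉ {n | g c (al n) ∈ U} :=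
        hfin.compl_mem_hyperfilter
      obtain ⟨n, hn1, hn2⟩ := ((hwi c).and h2).exists
      have hc : w c = true := hc
      rw [hc] at hn1
      have h3 := not_le.2 (hcon.1 n)
      simp only [mem_ofPred_eq] at hn2
      simp [v, S, h3, hcon.2, hn2] at hn1
    refine (Cardinal.mk_le_mk_of_subset hsub).trans ((Cardinal.mk_union_le _ _).trans ?_)
    refine Cardinal.add_le_of_le hτ ?_ ?_
    · refine (Cardinal.mk_iUnion_le _).trans ?_
      exact (mul_le_mul' hN (ciSup_le' fun j => hIic _)).trans (Cardinal.mul_eq_self hτ).le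
    · simpa using Cardinal.one_le_aleph0.trans hτ
  have hfinal := L (ULift.{u} ℕ) hyp hN v w hw (e i0)
  rw [hhE w hwE i0, if_pos hw0] at hfinal
  obtain ⟨n, hn⟩ := (hfinal.eventually (hO'.mem_nhds hqO)).exists
  have hn2 := hu (al n)
  rw [halU] at hn2
  exact Set.disjoint_left.1 hdisj hn2 hn

end helpers

/-- a `Σ_τ`-product of at least `τ⁺` many nontrivial compact Hausdorff
spaces of density at most `τ` is not subcompact. -/
theorem stmt_8 (τ : Cardinal.{u}) (hτ : ℵ₀ ≤ τ)
    (B : Type u) (hB : Order.succ τ ≤ #B)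
    (Xb : B → Type u) [∀ b, TopologicalSpace (Xb b)] [∀ b, CompactSpace (Xb b)]
    [∀ b, T2Space (Xb b)] (hnt : ∀ b, Nontrivial (Xb b))
    (hd : ∀ b, ∃ s : Set (Xb b), Dense s ∧ #s ≤ τ)
    (p : ∀ b, Xb b) :
    ¬ Subcompact ↥{x : ∀ b, Xb b | #{b | x b ≠ p b} ≤ τ} := by
  exact stmt_8_aux τ hτ B hB Xb hnt hd p
end

section
/- Let {X_β : β ∈ B} be a family of metrizable compact spaces, each with more than one point, where B is uncountable, and let p ∈ ∏{X_β : β ∈ B}. Then the Σ-product {x ∈ ∏X_β : x differs from p in at most countably many coordinates}, with the subspace topology of the product, is not subcompact, i.e., it admits no condensation onto a compact Hausdorff space. -/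
open Cardinal Topology

universe u

open Filter

section SigmaHelpers

variable {B : Type u} {Xb : B → Type u} [∀ b, TopologicalSpace (Xb b)]

/-- The `Σ`-product. -/
abbrev SigP (p : ∀ b, Xb b) : Type u := ↥{x : ∀ b, Xb b | {b | x b ≠ p b}.Countable}

/-- The retraction onto the coordinates in a countable set. -/
noncomputable def sigR (p : ∀ b, Xb b) (A : {A : Set B // A.Countable}) (z : ∀ b, Xb b) :
    SigP p := by
  classical
  exact ⟨fun b => if b ∈ A.1 then z b else p b, A.2.mono (by
    intro b hb
    by_contra h
    exact hb (by simp [h]))⟩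

theorem sigR_mem (p : ∀ b, Xb b) (A : {A : Set B // A.Countable}) (z : ∀ b, Xb b) {b : B}
    (hb : b ∈ A.1) : (sigR p A z).1 b = z b := by
  simp [sigR, hb]

theorem sigR_not_mem (p : ∀ b, Xb b) (A : {A : Set B // A.Countable}) (z : ∀ b, Xb b) {b : B}
    (hb : b ∉ A.1) : (sigR p A z).1 b = p b := by
  simp [sigR, hb]

theorem sigR_sigR (p : ∀ b, Xb b) (A A' : {A : Set B // A.Countable}) (h : A.1 ⊆ A'.1)
    (z : ∀ b, Xb b) : sigR p A (sigR p A' z).1 = sigR p A z := by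
  apply Subtype.ext
  funext b
  by_cases hb : b ∈ A.1
  · rw [sigR_mem p A _ hb, sigR_mem p A _ hb, sigR_mem p A' _ (h hb)]
  · rw [sigR_not_mem p A _ hb, sigR_not_mem p A _ hb]

theorem sigK_compact [∀ b, CompactSpace (Xb b)] [∀ b, T2Space (Xb b)] (p : ∀ b, Xb b)
    (A : Set B) (hA : A.Countable) : IsCompact {x : SigP p | ∀ b, b ∉ A → x.1 b = p b} := by
  rw [Topology.IsInducing.subtypeVal.isCompact_iff]
  have : (Subtype.val '' {x : SigP p | ∀ b, b ∉ A → x.1 b = p b})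
      = {x : ∀ b, Xb b | ∀ b, b ∉ A → x b = p b} := by
    ext x
    constructor
    · rintro ⟨y, hy, rfl⟩
      exact hy
    · intro hx
      refine ⟨⟨x, hA.mono ?_⟩, hx, rfl⟩
      intro b hb
      by_contra h
      exact hb (hx b h)
  rw [this]
  apply IsClosed.isCompact
  simp only [Set.ofPred_forall]
  refine isClosed_iInter fun b => isClosed_iInter fun _ => ?_
  exact isClosed_eq (continuous_apply b) continuous_const

theorem sig_eps [∀ b, CompactSpace (Xb b)] [∀ b, T2Space (Xb b)] (p : ∀ b, Xb b)
    (g : SigP p → ℝ) (hg : Continuous g) (ε : ℝ) (hε : 0 < ε) :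
    ∃ A : {A : Set B // A.Countable}, ∀ x : SigP p, |g x - g (sigR p A x.1)| ≤ ε := by
  by_contra! hcon
  choose X hX using hcon
  let nxt : {A : Set B // A.Countable} → {A : Set B // A.Countable} :=
    fun A => ⟨A.1 ∪ {b | (X A).1 b ≠ p b}, A.2.union (X A).2⟩
  let S : ℕ → {A : Set B // A.Countable} := fun n => nxt^[n] ⟨∅, Set.countable_empty⟩
  have hS : ∀ n, S (n + 1) = nxt (S n) := fun n => Function.iterate_succ_apply' _ _ _
  have hmono : Monotone fun n => (S n).1 := by
    apply monotone_nat_of_le_succ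
    intro n
    rw [hS]
    exact Set.subset_union_left
  let A : Set B := ⋃ n, (S n).1
  have hA : A.Countable := Set.countable_iUnion fun n => (S n).2
  have hK := sigK_compact p A hA
  have hxK : ∀ n, X (S n) ∈ {x : SigP p | ∀ b, b ∉ A → x.1 b = p b} := by
    intro n b hb
    by_contra h
    apply hb
    refine Set.mem_iUnion.2 ⟨n + 1, ?_⟩
    rw [hS]
    exact Or.inr h
  let U : Ultrafilter ℕ := Ultrafilter.of atTop
  have hU : (U : Filter ℕ) ≤ atTop := Ultrafilter.of_le atTop
  obtain ⟨x, hx, hlim⟩ := hK.ultrafilter_le_nhds (U.map fun n => X (S n)) (by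
    rw [le_principal_iff]
    exact Filter.mem_map.2 (Filter.univ_mem' hxK))
  have h1 : Tendsto (fun n => X (S n)) U (𝓝 x) := hlim
  have h2 : Tendsto (fun n => sigR p (S n) (X (S n)).1) U (𝓝 x) := by
    rw [tendsto_subtype_rng, tendsto_pi_nhds] at h1 ⊢
    intro b
    refine (h1 b).congr' ?_
    by_cases hb : b ∈ A
    · obtain ⟨m, hm⟩ := Set.mem_iUnion.1 hb
      filter_upwards [hU (eventually_ge_atTop m)] with n hn
      exact (sigR_mem p _ _ (hmono hn hm)).symm
    · refine Eventually.of_forall fun n => ?_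
      exact (hxK n b hb).trans
        (sigR_not_mem p (S n) _ (fun h => hb (Set.mem_iUnion.2 ⟨n, h⟩))).symm
  have h3 := (((hg.tendsto x).comp h1).sub ((hg.tendsto x).comp h2)).abs
  have h4 : ε ≤ |g x - g x| :=
    ge_of_tendsto h3 (Eventually.of_forall fun n => (hX (S n)).le)
  simp at h4
  linarith

theorem sig_dep [∀ b, CompactSpace (Xb b)] [∀ b, T2Space (Xb b)] (p : ∀ b, Xb b)
    (g : SigP p → ℝ) (hg : Continuous g) :
    ∃ A : {A : Set B // A.Countable}, ∀ x : SigP p, g x = g (sigR p A x.1) := by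
  choose S hS using fun n : ℕ => sig_eps p g hg (1 / ((n : ℝ) + 1)) (by positivity)
  refine ⟨⟨⋃ n, (S n).1, Set.countable_iUnion fun n => (S n).2⟩, fun x => ?_⟩
  have key : ∀ n : ℕ, |g x - g (sigR p ⟨⋃ n, (S n).1, Set.countable_iUnion fun n => (S n).2⟩ x.1)|
      ≤ 1 / ((n : ℝ) + 1) + 1 / ((n : ℝ) + 1) := by
    intro n
    have h1 := hS n x
    have h2 := hS n (sigR p ⟨⋃ n, (S n).1, Set.countable_iUnion fun n => (S n).2⟩ x.1)
    rw [sigR_sigR p (S n) _ (Set.subset_iUnion (fun n => (S n).1) n)] at h2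
    rw [abs_le] at *
    constructor <;> linarith [h1.1, h1.2, h2.1, h2.2]
  have hl := (tendsto_one_div_add_atTop_nhds_zero_nat (𝕜 := ℝ)).add
    (tendsto_one_div_add_atTop_nhds_zero_nat (𝕜 := ℝ))
  have h0 := ge_of_tendsto' hl key
  rw [add_zero] at h0
  exact sub_eq_zero.1 (abs_eq_zero.1 (le_antisymm h0 (abs_nonneg _)))

theorem sig_ext (p : ∀ b, Xb b) {Y : Type u} [TopologicalSpace Y] [CompactSpace Y]
    (f : SigP p → Y) (d : ∀ b, Xb b) :
    ∃ y : Y, ∀ g : Y → ℝ, Continuous g → ∀ A : {A : Set B // A.Countable},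
      (∀ x : SigP p, g (f x) = g (f (sigR p A x.1))) → g y = g (f (sigR p A d)) := by
  have : IsDirectedOrder {A : Set B // A.Countable} :=
    ⟨fun a b => ⟨⟨a.1 ∪ b.1, a.2.union b.2⟩, Set.subset_union_left, Set.subset_union_right⟩⟩
  have : Nonempty {A : Set B // A.Countable} := ⟨⟨∅, Set.countable_empty⟩⟩
  let U : Ultrafilter {A : Set B // A.Countable} := Ultrafilter.of atTop
  have hU : (U : Filter {A : Set B // A.Countable}) ≤ atTop := Ultrafilter.of_le atTop
  obtain ⟨y, -, hy⟩ := isCompact_univ.ultrafilter_le_nhds (U.map fun A => f (sigR p A d)) (by simp)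
  have h1 : Tendsto (fun A => f (sigR p A d)) U (𝓝 y) := hy
  refine ⟨y, fun g hg A hA => ?_⟩
  have h2 := (hg.tendsto y).comp h1
  refine tendsto_nhds_unique h2 ?_
  refine tendsto_const_nhds.congr' ?_
  filter_upwards [hU (eventually_ge_atTop A)] with A' hA'
  simp only [Function.comp]
  rw [hA (sigR p A' d), sigR_sigR p A A' hA']

end SigmaHelpers

/-- an uncountable `Σ`-product of nontrivial metrizable compact spaces is
not subcompact. -/
theorem stmt_9 (B : Type u) [Uncountable B]
    (Xb : B → Type u) [∀ b, TopologicalSpace (Xb b)] [∀ b, CompactSpace (Xb b)]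
    [∀ b, TopologicalSpace.MetrizableSpace (Xb b)] (hnt : ∀ b, Nontrivial (Xb b))
    (p : ∀ b, Xb b) :
    ¬ Subcompact ↥{x : ∀ b, Xb b | {b | x b ≠ p b}.Countable} := by
  classical
  rintro ⟨Y, _, hYc, hY2, f, hf, hfb⟩
  -- an uncountable subset of size at most continuum
  obtain ⟨B', hB'⟩ : ∃ s : Set B, #s = ℵ₁ := by
    rw [← Cardinal.le_mk_iff_exists_set, ← Cardinal.succ_aleph0, Order.succ_le_iff]
    exact Cardinal.aleph0_lt_mk
  have hB'u : ¬ B'.Countable := by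
    rw [← Cardinal.le_aleph0_iff_set_countable, hB', not_le]
    exact Cardinal.aleph0_lt_aleph_one
  obtain ⟨φ⟩ : Nonempty (B' ↪ ℝ) := by
    rw [← Cardinal.lift_mk_le', hB', Cardinal.mk_real]
    simpa using Cardinal.aleph_one_le_continuum
  choose q hq using fun b => exists_ne (p b)
  let d : ℚ × ℚ → ∀ b, Xb b := fun n b =>
    if ∃ h : b ∈ B', (n.1 : ℝ) < φ ⟨b, h⟩ ∧ φ ⟨b, h⟩ < n.2 then q b else p b
  choose y hy using fun n => sig_ext p f (d n)
  choose w hw using fun n => hfb.2 (y n)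
  let A : Set B := ⋃ n, {b | (w n).1 b ≠ p b}
  have hA : A.Countable := Set.countable_iUnion fun n => (w n).2
  have hK := ((sigK_compact p A hA).image hf).isClosed
  obtain ⟨b, hb, hbA⟩ : ∃ b ∈ B', b ∉ A := by
    by_contra! h
    exact hB'u (hA.mono h)
  -- the test point
  let x : SigP p := sigR p ⟨{b}, Set.countable_singleton b⟩ q
  have hxb : x.1 b = q b := sigR_mem p _ _ rfl
  have hxo : ∀ c, c ≠ b → x.1 c = p c := fun c hc => sigR_not_mem p _ _ hc
  have hxK : f x ∉ f '' {x : SigP p | ∀ b, b ∉ A → x.1 b = p b} := by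
    rintro ⟨x', hx', he⟩
    rw [hfb.1 he] at hx'
    exact hq b (hxb.symm.trans (hx' b hbA))
  obtain ⟨g, hg0, hg1, -⟩ := exists_continuous_zero_one_of_isClosed
    (isClosed_singleton (x := f x)) hK (Set.disjoint_singleton_left.2 hxK)
  have hgy : ∀ n, g (y n) = 1 := by
    intro n
    refine hg1 ⟨w n, ?_, hw n⟩
    intro c hc
    by_contra h
    exact hc (Set.mem_iUnion.2 ⟨n, h⟩)
  have hgc : Continuous fun z => g (f z) := g.continuous.comp hf
  obtain ⟨C, hC⟩ := sig_dep p (fun z => g (f z)) hgc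
  have hd1 : ∀ n, g (f (sigR p C (d n))) = 1 := fun n => by
    rw [← hy n g g.continuous C hC, hgy n]
  have hx0 : g (f (sigR p C x.1)) = 0 := by
    rw [← hC x]
    exact hg0 rfl
  -- neighbourhood where g ∘ f < 1
  have hnh : {z : SigP p | g (f z) < 1} ∈ 𝓝 (sigR p C x.1) :=
    (isOpen_lt hgc continuous_const).mem_nhds (by simp [hx0])
  rw [nhds_subtype_eq_comap, mem_comap] at hnh
  obtain ⟨V, hV, hVs⟩ := hnh
  rw [nhds_pi, Filter.mem_pi] at hV
  obtain ⟨T, hT, t, ht, hts⟩ := hV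
  -- interval around φ b avoiding the rest of T
  have hfin : ((fun c : B' => φ c) '' {c : B' | c.1 ∈ T ∧ c.1 ≠ b}).Finite := by
    apply Set.Finite.image
    exact (hT.preimage (Subtype.val_injective.injOn)).subset fun c hc => hc.1
  have hop : ((fun c : B' => φ c) '' {c : B' | c.1 ∈ T ∧ c.1 ≠ b})ᶜ ∈ 𝓝 (φ ⟨b, hb⟩) := by
    apply hfin.isClosed.isOpen_compl.mem_nhds
    rintro ⟨c, hc, he⟩
    exact hc.2 (congrArg Subtype.val (φ.injective he))
  obtain ⟨l, r, hlr, hsub⟩ := mem_nhds_iff_exists_Ioo_subset.1 hop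
  obtain ⟨l', hl1, hl2⟩ := exists_rat_btwn hlr.1
  obtain ⟨r', hr1, hr2⟩ := exists_rat_btwn hlr.2
  have hagree : ∀ c ∈ T, d (l', r') c = x.1 c := by
    intro c hc
    by_cases hcb : c = b
    · subst hcb
      rw [hxb]
      exact if_pos ⟨hb, hl2, hr1⟩
    · rw [hxo c hcb]
      refine if_neg ?_
      rintro ⟨h, h1, h2⟩
      exact hsub ⟨hl1.trans h1, h2.trans hr2⟩ ⟨⟨c, h⟩, ⟨hc, hcb⟩, rfl⟩
  have hin : (sigR p C (d (l', r'))).1 ∈ V := by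
    apply hts
    intro c hc
    have : (sigR p C (d (l', r'))).1 c = (sigR p C x.1).1 c := by
      by_cases hcC : c ∈ C.1
      · rw [sigR_mem p C _ hcC, sigR_mem p C _ hcC, hagree c hc]
      · rw [sigR_not_mem p C _ hcC, sigR_not_mem p C _ hcC]
    rw [this]
    exact mem_of_mem_nhds (ht c)
  have hlt : g (f (sigR p C (d (l', r')))) < 1 := hVs hin
  exact absurd (hd1 (l', r')) hlt.ne
end

section
/- For every infinite cardinal τ there exists a compact Hausdorff space X such that the character χ(x, X) > τ at every point x ∈ X, yet X is not an a_τ-space. -/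
open Cardinal Topology

universe u

open Set Filter Function

/-- Gleason cover. -/
lemma gleason_cover (A : Type u) [TopologicalSpace A] [CompactSpace A] [T2Space A] :
    ∃ (X : Type u) (_ : TopologicalSpace X) (_ : CompactSpace X) (_ : T2Space X)
      (_ : ExtremallyDisconnected X) (p : X → A), Continuous p ∧ Surjective p ∧
      ∀ E₀ : Set X, E₀ ≠ Set.univ → IsClosed E₀ → p '' E₀ ≠ Set.univ := by
  obtain ⟨B, _, _, e, he⟩ : ∃ (B : Type u) (_ : TopologicalSpace B) (_ : DiscreteTopology B)
      (e : B → A), Surjective e :=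
    ⟨A, ⊥, @DiscreteTopology.mk A ⊥ rfl, id, surjective_id⟩
  have hec : Continuous e := continuous_of_discreteTopology
  let φ : StoneCech B → A := stoneCechExtend hec
  have hφ : Continuous φ := continuous_stoneCechExtend hec
  have hφs : Surjective φ := fun a => by
    obtain ⟨b, rfl⟩ := he a
    exact ⟨stoneCechUnit b, stoneCechExtend_stoneCechUnit hec b⟩
  obtain ⟨E, hE, hEu, hmin⟩ := exists_compact_surjective_zorn_subset hφ hφs
  let p : E → A := E.domRestrict φ
  have hp : Continuous p := hφ.comp continuous_subtype_val
  have hps : Surjective p := fun a => by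
    obtain ⟨d, hd, rfl⟩ := (hEu ▸ mem_univ a : a ∈ φ '' E)
    exact ⟨⟨d, hd⟩, rfl⟩
  obtain ⟨h, hh, hhe⟩ := StoneCech.projective (X := B) hφ hp hps
  let k : E → E := fun x => h x
  have hk : Continuous k := hh.comp continuous_subtype_val
  have hpk : ∀ x, p (k x) = p x := fun x => congrFun hhe x.1
  have kid : ∀ x, k x = x := by
    intro x
    by_contra hne
    obtain ⟨W, V, hW, hV, hxW, hxV, hd⟩ := t2_separation hne
    let U := V ∩ k ⁻¹' W
    have hU : IsOpen U := hV.inter (hW.preimage hk)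
    refine hmin Uᶜ ?_ hU.isClosed_compl ?_
    · intro hc
      have : x ∈ Uᶜ := hc ▸ mem_univ x
      exact this ⟨hxV, hxW⟩
    · refine eq_univ_of_forall fun a => ?_
      obtain ⟨y, rfl⟩ := hps a
      by_cases hy : y ∈ U
      · refine ⟨k y, fun hky => ?_, hpk y⟩
        exact disjoint_left.1 hd hy.2 hky.1
      · exact ⟨y, hy, rfl⟩
  have hproj : CompactT2.Projective E := by
    intro Y Z _ _ _ _ _ _ f g hf hg hgs
    obtain ⟨l, hl, hle⟩ := StoneCech.projective (X := B) (hf.comp hh) hg hgs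
    refine ⟨fun x => l x, hl.comp continuous_subtype_val, funext fun x => ?_⟩
    have := congrFun hle x.1
    simp only [comp_apply] at this ⊢
    rw [this]
    exact congrArg f (kid x)
  exact ⟨E, inferInstance, hE, inferInstance, hproj.extremallyDisconnected, p, hp, hps, hmin⟩

lemma char_large (τ : Cardinal.{u}) (hτ : ℵ₀ ≤ τ) (ι : Type u) (hι : τ < #ι)
    (X : Type u) [TopologicalSpace X] [CompactSpace X]
    (p : X → (ι → Bool)) (hp : Continuous p) (hps : Surjective p)
    (hmin : ∀ E₀ : Set X, E₀ ≠ Set.univ → IsClosed E₀ → p '' E₀ ≠ Set.univ)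
    (x : X) (bs : Set (Set X)) (h1 : ∀ U ∈ bs, U ∈ nhds x)
    (h2 : ∀ V ∈ nhds x, ∃ U ∈ bs, U ⊆ V) : τ < #bs := by
  by_contra hlt
  push Not at hlt
  have key : ∀ U : bs, ∃ F : Finset ι, ∃ b : ι → Bool,
      ∀ b' : ι → Bool, (∀ i ∈ F, b' i = b i) → b' ∈ p '' U.1 := by
    intro U
    have hx : x ∈ interior U.1 := mem_interior_iff_mem_nhds.2 (h1 _ U.2)
    have hne : p '' (interior U.1)ᶜ ≠ Set.univ := by
      refine hmin _ ?_ isOpen_interior.isClosed_compl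
      intro hc
      have : x ∈ (interior U.1)ᶜ := hc ▸ mem_univ x
      exact this hx
    obtain ⟨b, hb⟩ := nonempty_compl.2 hne
    have ho : IsOpen (p '' (interior U.1)ᶜ)ᶜ :=
      (isOpen_interior.isClosed_compl.isCompact.image hp).isClosed.isOpen_compl
    obtain ⟨F, u, hu, hsub⟩ := isOpen_pi_iff.1 ho b hb
    refine ⟨F, b, fun b' hb' => ?_⟩
    have : b' ∈ (p '' (interior U.1)ᶜ)ᶜ := hsub fun i hi => by
      rw [hb' i hi]; exact (hu i hi).2
    obtain ⟨y, rfl⟩ := hps b'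
    refine ⟨y, ?_, rfl⟩
    by_contra hy
    exact this ⟨y, fun h => hy (interior_subset h), rfl⟩
  choose F b hb using key
  have hcard : #(⋃ U, (F U : Set ι)) ≤ τ := by
    refine (Cardinal.mk_iUnion_le _).trans ?_
    refine (mul_le_mul' hlt (ciSup_le' (a := ℵ₀) fun U => ?_)).trans (Cardinal.mul_eq_left hτ hτ Cardinal.aleph0_ne_zero).le
    exact (Cardinal.lt_aleph0_of_finite _).le
  obtain ⟨i, hi⟩ : ∃ i, i ∉ ⋃ U, (F U : Set ι) := by
    by_contra hc
    push Not at hc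
    rw [eq_univ_of_forall hc, Cardinal.mk_univ] at hcard
    exact absurd hcard (not_le.2 hι)
  obtain ⟨U, hU, hUV⟩ := h2 {z | p z i = p x i} (by
    have : IsOpen {z | p z i = p x i} :=
      (isOpen_discrete {p x i}).preimage ((continuous_apply i).comp hp)
    exact this.mem_nhds rfl)
  classical
  obtain ⟨y, hy, hye⟩ := hb ⟨U, hU⟩ (Function.update (b ⟨U, hU⟩) i (!(p x i))) (fun j hj => by
    rw [Function.update_of_ne]
    rintro rfl
    exact hi (mem_iUnion.2 ⟨_, hj⟩))
  have h3 : p y i = p x i := hUV hy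
  rw [hye] at h3
  simp at h3

lemma extend_dense (X : Type u) [TopologicalSpace X] [CompactSpace X] [T2Space X]
    [ExtremallyDisconnected X] (Z : Set X) (hZ : Dense Z) (Y : Type u) [TopologicalSpace Y]
    [CompactSpace Y] [T2Space Y] (f : Z → Y) (hf : Continuous f) :
    ∃ g : X → Y, Continuous g ∧ ∀ z : Z, g z = f z := by
  let G : Set (X × Y) := closure (range fun z : Z => ((z : X), f z))
  have hG : CompactSpace G := isCompact_iff_compactSpace.1 isClosed_closure.isCompact
  have hfib : ∀ (z : Z) (y : Y), ((z : X), y) ∈ G → y = f z := by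
    intro z y hy
    by_contra hne
    obtain ⟨V, W, hV, hW, hyV, hfW, hd⟩ := t2_separation hne
    obtain ⟨O, hO, hOW⟩ := isOpen_induced_iff.1 (hW.preimage hf)
    have hzO : (z : X) ∈ O := by
      have : z ∈ Subtype.val ⁻¹' O := by rw [hOW]; exact hfW
      exact this
    obtain ⟨_, ⟨hq1, hq2⟩, w, rfl⟩ := mem_closure_iff.1 hy (O ×ˢ V) (hO.prod hV) ⟨hzO, hyV⟩
    have : w ∈ f ⁻¹' W := by rw [← hOW]; exact hq1
    exact disjoint_left.1 hd hq2 this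
  let q : G → X := fun w => w.1.1
  have hq : Continuous q := continuous_fst.comp continuous_subtype_val
  have hqs : Surjective q := by
    have hcl : IsClosed (range q) := (isCompact_range hq).isClosed
    have hsub : Z ⊆ range q := fun z hz =>
      ⟨⟨(z, f ⟨z, hz⟩), subset_closure ⟨⟨z, hz⟩, rfl⟩⟩, rfl⟩
    intro x
    have := closure_minimal hsub hcl (hZ x)
    exact this
  obtain ⟨s, hs, hse⟩ := CompactT2.ExtremallyDisconnected.projective (A := X)
    continuous_id hq hqs
  refine ⟨fun x => (s x).1.2, continuous_snd.comp (continuous_subtype_val.comp hs), fun z => ?_⟩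
  apply hfib
  have h1 : (s z).1.1 = z := congrFun hse z
  have h2 := (s z).2
  have h3 : ((s z).1.1, (s z).1.2) ∈ G := h2
  rwa [h1] at h3

/-- A free ultrafilter containing a given infinite set. -/
lemma exists_free (N : Set ℕ) (hN : N.Infinite) :
    ∃ 𝓤 : Ultrafilter ℕ, N ∈ 𝓤 ∧ ∀ M ∈ 𝓤, M.Infinite := by
  have := hN.cofinite_inf_principal_neBot
  let 𝓤 := Ultrafilter.of (cofinite ⊓ 𝓟 N)
  have hle : (𝓤 : Filter ℕ) ≤ cofinite ⊓ 𝓟 N := Ultrafilter.of_le _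
  refine ⟨𝓤, ?_, ?_⟩
  · exact (hle.trans inf_le_right) (mem_principal_self N)
  · intro M hM hfin
    have : Mᶜ ∈ 𝓤 := (hle.trans inf_le_left) hfin.compl_mem_cofinite
    exact Ultrafilter.compl_notMem_iff.2 hM this

lemma split_infinite (N : Set ℕ) (hN : N.Infinite) :
    ∃ N₁ N₂ : Set ℕ, N₁ ⊆ N ∧ N₂ ⊆ N ∧ N₁.Infinite ∧ N₂.Infinite ∧ Disjoint N₁ N₂ := by
  have := hN.to_subtype
  let e := Infinite.natEmbedding N
  have he : Injective fun n => (e n : ℕ) := Subtype.val_injective.comp e.injective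
  refine ⟨range fun n => (e (2 * n) : ℕ), range fun n => (e (2 * n + 1) : ℕ), ?_, ?_, ?_, ?_, ?_⟩
  · rintro _ ⟨n, rfl⟩; exact (e _).2
  · rintro _ ⟨n, rfl⟩; exact (e _).2
  · apply infinite_range_of_injective
    intro a b h
    have := he h
    omega
  · apply infinite_range_of_injective
    intro a b h
    have := he h
    omega
  · rw [Set.disjoint_left]
    rintro _ ⟨n, rfl⟩ ⟨m, hm⟩
    have := he hm
    omega

/-- The core combinatorial argument. -/
lemma core (X Y : Type u) [TopologicalSpace X] [CompactSpace X] [T2Space X]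
    [ExtremallyDisconnected X] [TopologicalSpace Y] [T2Space Y]
    (O : ℕ → Set X) (hO : ∀ n, IsOpen (O n)) (hOd : Pairwise (Disjoint on O))
    (c : ℕ → X) (hc : ∀ n, c n ∈ O n) (g : X → Y) (hg : Continuous g)
    (hinj : ∀ x y, x ∉ range c → y ∉ range c → g x = g y → x = y)
    (r : ℕ → X) (hr : ∀ n, r n ∉ range c) (hgr : ∀ n, g (r n) = g (c n)) : False := by
  have hV : ∀ n, ∃ V : Set X, IsOpen V ∧ c n ∈ V ∧ V ⊆ O n ∧ r n ∉ closure V := by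
    intro n
    have hne : c n ≠ r n := fun h => hr n ⟨n, h⟩
    obtain ⟨P, Q, hP, hQ, hcP, hrQ, hd⟩ := t2_separation hne
    refine ⟨P ∩ O n, hP.inter (hO n), ⟨hcP, hc n⟩, inter_subset_right, fun h => ?_⟩
    obtain ⟨z, hz1, hz2⟩ := mem_closure_iff.1 h Q hQ hrQ
    exact disjoint_left.1 hd hz2.1 hz1
  choose V hVo hcV hVO hrV using hV
  have hVd : Pairwise (Disjoint on V) := fun i j hij => (hOd hij).mono (hVO i) (hVO j)
  let K : Set ℕ → Set X := fun N => closure (⋃ n ∈ N, V n)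
  have hUo : ∀ N : Set ℕ, IsOpen (⋃ n ∈ N, V n) := fun N => isOpen_biUnion fun n _ => hVo n
  have hKo : ∀ N, IsOpen (K N) := fun N => ExtremallyDisconnected.open_closure _ (hUo N)
  have hKc : ∀ N, IsClosed (K N) := fun N => isClosed_closure
  have hKd : ∀ N M, Disjoint N M → Disjoint (K N) (K M) := by
    intro N M h
    apply ExtremallyDisconnected.disjoint_closure_of_disjoint_isOpen _ (hUo N) (hUo M)
    simp only [Set.disjoint_iUnion_left, Set.disjoint_iUnion_right]
    intro i hi j hj
    exact hVd (fun hij => Set.disjoint_left.1 h hj (by simpa [hij] using hi)) 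
  have hcK : ∀ N : Set ℕ, ∀ n ∈ N, c n ∈ K N := fun N n hn =>
    subset_closure (mem_biUnion hn (hcV n))
  have hKu : ∀ N M, K (N ∪ M) = K N ∪ K M := by
    intro N M
    simp only [K, biUnion_union, closure_union]
  have hVK : ∀ n, closure (V n) = K {n} := fun n => by simp [K]
  have hcn : ∀ k n, c n ∈ K {k} → n = k := by
    intro k n h
    by_contra hne
    exact Set.disjoint_left.1 (hKd {k} {n} (by simpa using Ne.symm hne)) h (hcK _ _ rfl)
  -- limits along ultrafilters
  have hlim : ∀ (𝓤 : Ultrafilter ℕ) (a : ℕ → X), ∃ x, Tendsto a 𝓤 (𝓝 x) := by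
    intro 𝓤 a
    obtain ⟨x, -, hx⟩ := isCompact_univ.ultrafilter_le_nhds (𝓤.map a) (by simp)
    exact ⟨x, hx⟩
  -- free limits of c are not in any K {k}
  have hfree : ∀ 𝓤 : Ultrafilter ℕ, (∀ M ∈ 𝓤, M.Infinite) → ∀ x, Tendsto c 𝓤 (𝓝 x) →
      ∀ k, x ∉ K {k} := by
    intro 𝓤 h𝓤 x hx k hk
    have := hx ((hKo {k}).mem_nhds hk)
    refine h𝓤 _ this ((finite_singleton k).subset fun n hn => ?_)
    exact hcn k n hn
  have hfreeC : ∀ 𝓤 : Ultrafilter ℕ, (∀ M ∈ 𝓤, M.Infinite) → ∀ x, Tendsto c 𝓤 (𝓝 x) →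
      x ∉ range c := by
    rintro 𝓤 h𝓤 _ hx ⟨k, rfl⟩
    exact hfree 𝓤 h𝓤 _ hx k (hcK _ _ rfl)
  have hglim : ∀ (𝓤 : Ultrafilter ℕ) x y, Tendsto c 𝓤 (𝓝 x) → Tendsto r 𝓤 (𝓝 y) →
      g y = g x := by
    intro 𝓤 x y hx hy
    have h1 : Tendsto (fun n => g (c n)) 𝓤 (𝓝 (g x)) := (hg.tendsto x).comp hx
    have h2 : Tendsto (fun n => g (r n)) 𝓤 (𝓝 (g y)) := (hg.tendsto y).comp hy
    simp only [hgr] at h2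
    exact tendsto_nhds_unique h2 h1
  have hcl : ∀ (𝓤 : Ultrafilter ℕ) (a : ℕ → X) x (S : Set X), IsClosed S → Tendsto a 𝓤 (𝓝 x) →
      {n | a n ∈ S} ∈ 𝓤 → x ∈ S := fun 𝓤 a x S hS hx h => hS.mem_of_tendsto hx h
  -- case a is impossible
  have hfin : ∀ k, {n | r n ∈ K {k}}.Finite := by
    intro k
    by_contra hinf
    obtain ⟨N₁, N₂, hs₁, hs₂, hi₁, hi₂, hd⟩ := split_infinite _ hinf
    have main : ∀ M : Set ℕ, M.Infinite → M ⊆ {n | r n ∈ K {k}} →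
        ∃ x ∈ K M, x ∉ range c ∧ g x = g (c k) := by
      intro M hM hMs
      obtain ⟨𝓤, hM𝓤, h𝓤⟩ := exists_free M hM
      obtain ⟨x, hx⟩ := hlim 𝓤 c
      obtain ⟨y, hy⟩ := hlim 𝓤 r
      have hxc := hfreeC 𝓤 h𝓤 x hx
      have hgxy := hglim 𝓤 x y hx hy
      refine ⟨x, hcl 𝓤 c x _ (hKc M) hx (mem_of_superset hM𝓤 fun n hn => hcK M n hn), hxc, ?_⟩
      have hyk : y ∈ K {k} := hcl 𝓤 r y _ (hKc _) hy (mem_of_superset hM𝓤 hMs)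
      by_cases hyc : y ∈ range c
      · obtain ⟨n, rfl⟩ := hyc
        rw [← hgxy, hcn k n hyk]
      · have := hinj y x hyc hxc hgxy
        exact absurd (this ▸ hyk) (hfree 𝓤 h𝓤 x hx k)
    obtain ⟨x, hx, hxc, hgx⟩ := main N₁ hi₁ hs₁
    obtain ⟨y, hy, hyc, hgy⟩ := main N₂ hi₂ hs₂
    have := hinj x y hxc hyc (hgx.trans hgy.symm)
    exact Set.disjoint_left.1 (hKd _ _ hd) hx (this ▸ hy)
  -- recursive construction
  have step : ∀ M : {M : Set ℕ // M.Infinite}, ∃ n ∈ M.1, ∃ M' : {M : Set ℕ // M.Infinite},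
      M'.1 ⊆ M.1 ∧ n ∉ M'.1 ∧ r n ∉ K M'.1 ∧ ∀ m ∈ M'.1, r m ∉ K {n} := by
    rintro ⟨M, hM⟩
    obtain ⟨n, hn⟩ := hM.nonempty
    have hM2 : (M \ ({n} ∪ {m | r m ∈ K {n}})).Infinite :=
      hM.sdiff ((finite_singleton n).union (hfin n))
    obtain ⟨N₁, N₂, hs₁, hs₂, hi₁, hi₂, hd⟩ := split_infinite _ hM2
    have hor : r n ∉ K N₁ ∨ r n ∉ K N₂ := by
      by_contra h
      push Not at h
      exact Set.disjoint_left.1 (hKd _ _ hd) h.1 h.2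
    have fin : ∀ N' : Set ℕ, N'.Infinite → N' ⊆ (M \ ({n} ∪ {m | r m ∈ K {n}})) → r n ∉ K N' →
        ∃ n ∈ M, ∃ M' : {M : Set ℕ // M.Infinite},
      M'.1 ⊆ M ∧ n ∉ M'.1 ∧ r n ∉ K M'.1 ∧ ∀ m ∈ M'.1, r m ∉ K {n} := by
      intro N' hi hs hrn
      exact ⟨n, hn, ⟨N', hi⟩, fun x hx => (hs hx).1, fun h => (hs h).2 (Or.inl rfl), hrn,
        fun m hm h => (hs hm).2 (Or.inr h)⟩
    rcases hor with h | h
    · exact fin N₁ hi₁ hs₁ h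
    · exact fin N₂ hi₂ hs₂ h
  choose ν hν nxt hsub hnot hrK hrm using step
  let M : ℕ → {M : Set ℕ // M.Infinite} := fun i => nxt^[i] ⟨Set.univ, infinite_univ⟩
  have hMs : ∀ i, M (i + 1) = nxt (M i) := fun i => iterate_succ_apply' _ _ _
  have hanti : Antitone fun i => (M i).1 := antitone_nat_of_succ_le fun i => by
    change (M (i + 1)).1 ⊆ (M i).1
    rw [hMs]; exact hsub _
  let n : ℕ → ℕ := fun i => ν (M i)
  have hnM : ∀ i j, i < j → n j ∈ (nxt (M i)).1 := by
    intro i j hij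
    rw [← hMs]
    exact hanti (Nat.succ_le_of_lt hij) (hν (M j))
  have hninj : Injective n := by
    have : ∀ i j, i < j → n i ≠ n j := fun i j hij h => hnot (M i) (by
      have := hnM i j hij
      rw [← h] at this
      exact this)
    intro i j h
    rcases lt_trichotomy i j with hij | hij | hij
    · exact absurd h (this i j hij)
    · exact hij
    · exact absurd h.symm (this j i hij)
  let N := range n
  have hNinf : N.Infinite := infinite_range_of_injective hninj
  have hrN : ∀ m ∈ N, r m ∉ K N := by
    rintro _ ⟨i, rfl⟩ h
    have hNs : N ⊆ (n '' Set.Iic i) ∪ (nxt (M i)).1 := by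
      rintro _ ⟨j, rfl⟩
      rcases le_or_gt j i with hj | hj
      · exact Or.inl ⟨j, hj, rfl⟩
      · exact Or.inr (hnM i j hj)
    have h2 : r (n i) ∈ K ((n '' Set.Iic i) ∪ (nxt (M i)).1) :=
      closure_mono (biUnion_subset_biUnion_left hNs) h
    rw [hKu] at h2
    rcases h2 with h2 | h2
    · have hf : (n '' Set.Iic i).Finite := (Set.finite_Iic i).image n
      simp only [K, hf.closure_biUnion] at h2
      obtain ⟨_, ⟨j, hj, rfl⟩, hm⟩ := mem_iUnion₂.1 h2
      rcases (show j ≤ i from hj).lt_or_eq with hj | rfl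
      · rw [hVK] at hm
        exact hrm (M j) _ (hnM j i hj) hm
      · exact hrV _ hm
    · exact hrK (M i) h2
  obtain ⟨𝓤, hN𝓤, h𝓤⟩ := exists_free N hNinf
  obtain ⟨x, hx⟩ := hlim 𝓤 c
  obtain ⟨y, hy⟩ := hlim 𝓤 r
  have hxc := hfreeC 𝓤 h𝓤 x hx
  have hgxy := hglim 𝓤 x y hx hy
  have hxK : x ∈ K N := hcl 𝓤 c x _ (hKc N) hx (mem_of_superset hN𝓤 fun n hn => hcK N n hn)
  have hyK : y ∈ (K N)ᶜ := hcl 𝓤 r y _ (hKo N).isClosed_compl hy (mem_of_superset hN𝓤 hrN)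
  by_cases hyc : y ∈ range c
  · obtain ⟨k, rfl⟩ := hyc
    exact h𝓤 _ (hy ((hKo {k}).mem_nhds (hcK _ _ rfl))) (hfin k)
  · exact hyK ((hinj y x hyc hxc hgxy) ▸ hxK)

/-- for every infinite cardinal `τ` there is a compact Hausdorff space
whose character at every point exceeds `τ` (every neighborhood base at each point has
cardinality `> τ`) but which is not an `a_τ`-space. -/
theorem stmt_18 (τ : Cardinal.{u}) (hτ : ℵ₀ ≤ τ) :
    ∃ (X : Type u) (_ : TopologicalSpace X), CompactSpace X ∧ T2Space X ∧
      (∀ x : X, ∀ bs : Set (Set X),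
        ((∀ U ∈ bs, U ∈ nhds x) ∧ ∀ V ∈ nhds x, ∃ U ∈ bs, U ⊆ V) → τ < #bs) ∧
      ¬ ATauSpace τ X := by
  obtain ⟨ι, hι⟩ : ∃ ι : Type u, τ < #ι := ⟨(2 ^ τ : Cardinal.{u}).out, by
    rw [Cardinal.mk_out]; exact Cardinal.cantor τ⟩
  obtain ⟨X, _, _, _, _, p, hp, hps, hmin⟩ := gleason_cover (ι → Bool)
  have hchar : ∀ x : X, ∀ bs : Set (Set X),
      ((∀ U ∈ bs, U ∈ nhds x) ∧ ∀ V ∈ nhds x, ∃ U ∈ bs, U ⊆ V) → τ < #bs :=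
    fun x bs h => char_large τ hτ ι hι X p hp hps hmin x bs h.1 h.2
  refine ⟨X, inferInstance, inferInstance, inferInstance, hchar, ?_⟩
  rintro ⟨-, -, hX⟩
  have hiso : ∀ x : X, ¬ IsOpen {x} := by
    intro x hx
    have := hchar x {{x}} ⟨by rintro U rfl; exact hx.mem_nhds rfl,
      fun V hV => ⟨{x}, rfl, singleton_subset_iff.2 (mem_of_mem_nhds hV)⟩⟩
    rw [Cardinal.mk_singleton] at this
    exact absurd (Cardinal.one_le_aleph0.trans hτ) (not_le.2 this)
  have hinf : Infinite X := by
    by_contra hfin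
    rw [not_infinite_iff_finite] at hfin
    obtain ⟨x, -⟩ := hps fun _ => true
    exact hiso x (isOpen_discrete _)
  obtain ⟨O, hOi, hO, hOd⟩ := exists_seq_infinite_isOpen_pairwise_disjoint X
  choose c hc using fun n => (hOi n).nonempty
  have hcard : #(range c) ≤ τ := (Cardinal.le_aleph0_iff_set_countable.2 (countable_range c)).trans hτ
  obtain ⟨Y, _, _, _, f, hf, hfi, hfs⟩ := hX (range c) hcard
  have hdense : Dense (range c)ᶜ := by
    rw [← interior_eq_empty_iff_dense_compl, eq_empty_iff_forall_notMem]
    intro x hx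
    obtain ⟨k, rfl⟩ := interior_subset hx
    have : interior (range c) ∩ O k = {c k} := by
      refine Subset.antisymm ?_ (singleton_subset_iff.2 ⟨hx, hc k⟩)
      rintro z ⟨hz, hzk⟩
      obtain ⟨m, rfl⟩ := interior_subset hz
      by_cases hmk : m = k
      · rw [hmk]; rfl
      · exact absurd hzk (Set.disjoint_left.1 (hOd hmk) (hc m))
    exact hiso (c k) (this ▸ isOpen_interior.inter (hO k))
  obtain ⟨g, hg, hgf⟩ := extend_dense X _ hdense Y f hf
  choose r hr using fun n => hfs (g (c n))
  refine core X Y O hO hOd c hc g hg ?_ (fun n => (r n : X)) (fun n => (r n).2) ?_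
  · intro x y hx hy h
    have h' : f ⟨x, hx⟩ = f ⟨y, hy⟩ := by rw [← hgf, ← hgf]; exact h
    exact congrArg Subtype.val (hfi h')
  · intro n
    exact (hgf (r n)).trans (hr n)
end
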